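/- arXiv:1506.00089 — 3 statements merged into one kernel-verified Lean document; each statement's English description precedes it below -/
import Mathlib

section
/- Under Condition 3 with 0 < d₁ < 1, for all sufficiently large p there exists c_{p,0} ∈ (0, c_p] satisfying (1/p)·Σ_{j=1}^p ( c_{p,0}/(γ_j − c_{p,0}) )² = n/p, and there is a constant M (independent of p) such that |c_{p,0} − c_p| ≤ M·a_p/n; consequently limsup_{p→∞} c_{p,0}/a_p < 1 and inf over large p of c_{p,0} is positive. -/
open MeasureTheory Filter

/-- Left edge of the Marchenko–Pastur type law with ratio `d`. -/
noncomputable def aMP (d : ℝ) : ℝ := (1 - Real.sqrt d) ^ 2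

/-- Right edge of the Marchenko–Pastur type law with ratio `d`. -/
noncomputable def bMP (d : ℝ) : ℝ := (1 + Real.sqrt d) ^ 2

/-- The Marchenko–Pastur type density `ϱ_d`. -/
noncomputable def rhoMP (d x : ℝ) : ℝ :=
  if aMP d ≤ x ∧ x ≤ bMP d then
    (1 / (2 * Real.pi * d * x)) * Real.sqrt ((bMP d - x) * (x - aMP d))
  else 0

/-- The total mass `∫ √((v²-x)(x-u²))/x` between the edges `u²` and `v²`. -/
theorem integral_sqrt_mul_div {u v : ℝ} (hu : 0 < u) (huv : u < v) :
    ∫ x in (u ^ 2)..(v ^ 2), Real.sqrt ((v ^ 2 - x) * (x - u ^ 2)) / x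
      = Real.pi / 2 * (v - u) ^ 2 := by
  have hv : 0 < v := hu.trans huv
  have hlt : u ^ 2 < v ^ 2 := by gcongr
  have hne : v ^ 2 - u ^ 2 ≠ 0 := by linarith
  have hcont : ContinuousOn (fun x : ℝ => Real.sqrt ((v ^ 2 - x) * (x - u ^ 2)) / x)
      (Set.Icc (u ^ 2) (v ^ 2)) := by
    apply ContinuousOn.div (by fun_prop) (by fun_prop)
    intro x hx
    have : 0 < u ^ 2 := by positivity
    linarith [hx.1]
  have key := intervalIntegral.integral_eq_sub_of_hasDerivAt_of_le
    (a := u ^ 2) (b := v ^ 2)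
    (f := fun x => Real.sqrt ((v ^ 2 - x) * (x - u ^ 2))
      + (u ^ 2 + v ^ 2) / 2 * Real.arcsin ((2 * x - u ^ 2 - v ^ 2) / (v ^ 2 - u ^ 2))
      - u * v * Real.arcsin
          (((u ^ 2 + v ^ 2) * x - 2 * (u ^ 2 * v ^ 2)) / (x * (v ^ 2 - u ^ 2))))
    (f' := fun x => Real.sqrt ((v ^ 2 - x) * (x - u ^ 2)) / x) hlt.le ?_ ?_
    (hcont.intervalIntegrable_of_Icc hlt.le)
  · rw [key]
    have e1 : (2 * v ^ 2 - u ^ 2 - v ^ 2) / (v ^ 2 - u ^ 2) = 1 := by field_simp; ring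
    have e2 : (2 * u ^ 2 - u ^ 2 - v ^ 2) / (v ^ 2 - u ^ 2) = -1 := by field_simp; ring
    have e3 : ((u ^ 2 + v ^ 2) * v ^ 2 - 2 * (u ^ 2 * v ^ 2)) / (v ^ 2 * (v ^ 2 - u ^ 2)) = 1 := by
      field_simp; ring
    have e4 : ((u ^ 2 + v ^ 2) * u ^ 2 - 2 * (u ^ 2 * v ^ 2)) / (u ^ 2 * (v ^ 2 - u ^ 2)) = -1 := by
      field_simp; ring
    simp only [e1, e2, e3, e4, Real.arcsin_one, Real.arcsin_neg_one, sub_self, zero_mul, mul_zero,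
      Real.sqrt_zero]
    ring
  · apply ContinuousOn.sub
    · apply ContinuousOn.add (by fun_prop)
      apply ContinuousOn.mul (by fun_prop)
      apply Real.continuous_arcsin.comp_continuousOn
      fun_prop
    · apply ContinuousOn.mul (by fun_prop)
      apply Real.continuous_arcsin.comp_continuousOn
      apply ContinuousOn.div (by fun_prop) (by fun_prop)
      intro x hx
      have h0 : 0 < u ^ 2 := by positivity
      exact mul_ne_zero (by linarith [hx.1]) hne
  · intro x hx
    obtain ⟨hx1, hx2⟩ := hx
    have hx0 : 0 < x := lt_trans (by positivity) hx1
    have hpos : 0 < (v ^ 2 - x) * (x - u ^ 2) := mul_pos (by linarith) (by linarith)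
    have hD : 0 < v ^ 2 - u ^ 2 := by linarith
    set R := Real.sqrt ((v ^ 2 - x) * (x - u ^ 2)) with hR
    have hR0 : 0 < R := Real.sqrt_pos.2 hpos
    have hRsq : R ^ 2 = (v ^ 2 - x) * (x - u ^ 2) := Real.sq_sqrt hpos.le
    have s1 : Real.sqrt (1 - ((2 * x - u ^ 2 - v ^ 2) / (v ^ 2 - u ^ 2)) ^ 2)
        = 2 * R / (v ^ 2 - u ^ 2) := by
      rw [Real.sqrt_eq_iff_mul_self_eq_of_pos (by positivity)]
      field_simp
      rw [hRsq]; ring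
    have s2 : Real.sqrt (1 - (((u ^ 2 + v ^ 2) * x - 2 * (u ^ 2 * v ^ 2)) /
          (x * (v ^ 2 - u ^ 2))) ^ 2) = 2 * (u * v) * R / (x * (v ^ 2 - u ^ 2)) := by
      rw [Real.sqrt_eq_iff_mul_self_eq_of_pos (by positivity)]
      field_simp
      rw [hRsq]; ring
    have n1 : (0 : ℝ) < 1 - ((2 * x - u ^ 2 - v ^ 2) / (v ^ 2 - u ^ 2)) ^ 2 :=
      Real.sqrt_pos.1 (by rw [s1]; positivity)
    have n2 : (0 : ℝ) < 1 - (((u ^ 2 + v ^ 2) * x - 2 * (u ^ 2 * v ^ 2)) /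
          (x * (v ^ 2 - u ^ 2))) ^ 2 :=
      Real.sqrt_pos.1 (by rw [s2]; positivity)
    have hprod : HasDerivAt (fun y : ℝ => (v ^ 2 - y) * (y - u ^ 2))
        ((-1) * (x - u ^ 2) + (v ^ 2 - x) * 1) x :=
      ((hasDerivAt_id x).const_sub (v ^ 2)).mul ((hasDerivAt_id x).sub_const (u ^ 2))
    have d1 := hprod.sqrt hpos.ne'
    have h2 : HasDerivAt (fun y : ℝ => (2 * y - u ^ 2 - v ^ 2) / (v ^ 2 - u ^ 2))
        (2 * 1 / (v ^ 2 - u ^ 2)) x :=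
      ((((hasDerivAt_id x).const_mul 2).sub_const _).sub_const _).div_const _
    have d2 := (Real.hasDerivAt_arcsin (x := (2 * x - u ^ 2 - v ^ 2) / (v ^ 2 - u ^ 2))
      (by intro h; rw [h] at n1; norm_num at n1) (by intro h; rw [h] at n1; norm_num at n1)).comp x h2
    have h3 : HasDerivAt (fun y : ℝ => ((u ^ 2 + v ^ 2) * y - 2 * (u ^ 2 * v ^ 2)) /
        (y * (v ^ 2 - u ^ 2)))
        ((((u ^ 2 + v ^ 2) * 1) * (x * (v ^ 2 - u ^ 2)) -
          ((u ^ 2 + v ^ 2) * x - 2 * (u ^ 2 * v ^ 2)) * (1 * (v ^ 2 - u ^ 2)))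
          / (x * (v ^ 2 - u ^ 2)) ^ 2) x :=
      (((hasDerivAt_id x).const_mul _).sub_const _).div ((hasDerivAt_id x).mul_const _)
        (by positivity)
    have d3 := (Real.hasDerivAt_arcsin
      (x := ((u ^ 2 + v ^ 2) * x - 2 * (u ^ 2 * v ^ 2)) / (x * (v ^ 2 - u ^ 2)))
      (by intro h; rw [h] at n2; norm_num at n2) (by intro h; rw [h] at n2; norm_num at n2)).comp x h3
    have d4 := (d1.add (d2.const_mul ((u ^ 2 + v ^ 2) / 2))).sub (d3.const_mul (u * v))
    refine d4.congr_deriv ?_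
    rw [s1, s2, ← hR]
    field_simp
    rw [hRsq]
    ring

theorem aMP_pos {d : ℝ} (h1 : d < 1) : 0 < aMP d := by
  have : Real.sqrt d < 1 := by rw [Real.sqrt_lt' one_pos]; simpa
  unfold aMP
  have : 0 < 1 - Real.sqrt d := by linarith
  positivity

theorem aMP_lt_bMP {d : ℝ} (h0 : 0 < d) : aMP d < bMP d := by
  have : 0 < Real.sqrt d := Real.sqrt_pos.2 h0
  unfold aMP bMP
  nlinarith

theorem aMP_le_one {d : ℝ} (h1 : d < 1) : aMP d ≤ 1 := by
  have : Real.sqrt d < 1 := by rw [Real.sqrt_lt' one_pos]; simpa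
  have := Real.sqrt_nonneg d
  unfold aMP
  nlinarith

theorem bMP_le_four {d : ℝ} (h1 : d < 1) : bMP d ≤ 4 := by
  have : Real.sqrt d < 1 := by rw [Real.sqrt_lt' one_pos]; simpa
  have := Real.sqrt_nonneg d
  unfold bMP
  nlinarith

theorem rhoMP_of_mem {d x : ℝ} (hx : x ∈ Set.Icc (aMP d) (bMP d)) :
    rhoMP d x = 1 / (2 * Real.pi * d * x) * Real.sqrt ((bMP d - x) * (x - aMP d)) :=
  if_pos hx

theorem rhoMP_nonneg {d : ℝ} (h0 : 0 < d) (x : ℝ) : 0 ≤ rhoMP d x := by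
  unfold rhoMP
  split_ifs with h
  · have : 0 ≤ x := le_trans (by unfold aMP; positivity) h.1
    positivity
  · exact le_rfl

theorem continuousOn_rhoMP {d : ℝ} (h0 : 0 < d) (h1 : d < 1) :
    ContinuousOn (rhoMP d) (Set.Icc (aMP d) (bMP d)) := by
  refine ContinuousOn.congr ?_ fun x hx => rhoMP_of_mem hx
  refine ContinuousOn.mul (ContinuousOn.div (by fun_prop) (by fun_prop) fun x hx => ?_)
    (by fun_prop)
  have : 0 < x := (aMP_pos h1).trans_le hx.1
  positivity

theorem integral_rhoMP {d : ℝ} (h0 : 0 < d) (h1 : d < 1) :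
    ∫ x in (aMP d)..(bMP d), rhoMP d x = 1 := by
  have hs : Real.sqrt d < 1 := by rw [Real.sqrt_lt' one_pos]; simpa
  have hs0 : 0 < Real.sqrt d := Real.sqrt_pos.2 h0
  have key := integral_sqrt_mul_div (u := 1 - Real.sqrt d) (v := 1 + Real.sqrt d)
    (by linarith) (by linarith)
  have : ∫ x in (aMP d)..(bMP d), rhoMP d x = ∫ x in (aMP d)..(bMP d),
      1 / (2 * Real.pi * d) * (Real.sqrt ((bMP d - x) * (x - aMP d)) / x) := by
    apply intervalIntegral.integral_congr
    intro x hx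
    rw [Set.uIcc_of_le (aMP_lt_bMP h0).le] at hx
    simp only [rhoMP_of_mem hx]
    have : 0 < x := (aMP_pos h1).trans_le hx.1
    field_simp
  rw [this, intervalIntegral.integral_const_mul]
  unfold aMP bMP
  rw [key]
  have : (1 + Real.sqrt d - (1 - Real.sqrt d)) ^ 2 = 4 * d := by
    linear_combination 4 * Real.sq_sqrt h0.le
  rw [this]
  field_simp
  norm_num

/-- Lower and upper Riemann-type sums along the `1/p`-quantiles of a density. -/
theorem quantile_sum_bounds {a b : ℝ} {ρ f : ℝ → ℝ} (hρ : ContinuousOn ρ (Set.Icc a b))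
    (hρ0 : ∀ x ∈ Set.Icc a b, 0 ≤ ρ x) (hf : ContinuousOn f (Set.Icc a b))
    (hanti : AntitoneOn f (Set.Icc a b)) {p : ℕ} (hp : 0 < p) {γ : ℕ → ℝ}
    (h0 : γ 0 = b) (hpa : γ p = a) (hmem : ∀ j ≤ p, γ j ∈ Set.Icc a b)
    (hq : ∀ j ≤ p, ∫ x in (γ j)..b, ρ x = (j : ℝ) / p) :
    ∫ x in a..b, f x * ρ x ≤ 1 / (p : ℝ) * ∑ j ∈ Finset.range p, f (γ (j + 1)) ∧
    1 / (p : ℝ) * ∑ j ∈ Finset.range p, f (γ j) ≤ ∫ x in a..b, f x * ρ x := by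
  have hp' : (0 : ℝ) < p := by exact_mod_cast hp
  have hint : ∀ {g : ℝ → ℝ}, ContinuousOn g (Set.Icc a b) → ∀ {s t : ℝ}, s ∈ Set.Icc a b →
      t ∈ Set.Icc a b → IntervalIntegrable g volume s t := fun hg s t hs ht =>
    (hg.mono (Set.uIcc_subset_Icc hs ht)).intervalIntegrable
  have hb : b ∈ Set.Icc a b := h0 ▸ hmem 0 (Nat.zero_le p)
  have hstep : ∀ j < p, ∫ x in (γ (j + 1))..(γ j), ρ x = 1 / p := by
    intro j hj
    have := intervalIntegral.integral_add_adjacent_intervals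
      (hint hρ (hmem (j + 1) hj) (hmem j hj.le)) (hint hρ (hmem j hj.le) hb)
    rw [hq j hj.le, hq (j + 1) hj] at this
    push_cast at this
    rw [eq_sub_of_add_eq this]
    ring
  have hmono : ∀ j < p, γ (j + 1) ≤ γ j := by
    intro j hj
    by_contra! hlt
    have h1 : 0 ≤ ∫ x in (γ j)..(γ (j + 1)), ρ x :=
      intervalIntegral.integral_nonneg hlt.le fun x hx =>
        hρ0 x ⟨(hmem j hj.le).1.trans hx.1, hx.2.trans (hmem (j + 1) hj).2⟩
    rw [intervalIntegral.integral_symm, hstep j hj] at h1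
    have : 0 < 1 / (p : ℝ) := by positivity
    linarith
  have hsum : ∑ j ∈ Finset.range p, ∫ x in (γ (j + 1))..(γ j), f x * ρ x
      = ∫ x in a..b, f x * ρ x := by
    have := intervalIntegral.sum_integral_adjacent_intervals (μ := volume)
      (f := fun x => f x * ρ x) (a := γ) (n := p)
      fun k hk => hint (hf.mul hρ) (hmem k (le_of_lt hk)) (hmem (k + 1) hk)
    rw [h0, hpa, intervalIntegral.integral_symm] at this
    rw [← neg_eq_iff_eq_neg.2 this, ← Finset.sum_neg_distrib]
    exact Finset.sum_congr rfl fun j _ => intervalIntegral.integral_symm _ _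
  rw [← hsum, Finset.mul_sum, Finset.mul_sum]
  constructor <;> refine Finset.sum_le_sum fun j hj => ?_ <;>
    rw [Finset.mem_range] at hj <;>
    rw [← hstep j hj, mul_comm, ← intervalIntegral.integral_const_mul] <;>
    refine intervalIntegral.integral_mono_on (hmono j hj) ?_ ?_ fun x hx => ?_
  · exact hint (hf.mul hρ) (hmem (j + 1) hj) (hmem j hj.le)
  · exact (hint hρ (hmem (j + 1) hj) (hmem j hj.le)).const_mul _
  · have hx' : x ∈ Set.Icc a b := ⟨(hmem (j + 1) hj).1.trans hx.1, hx.2.trans (hmem j hj.le).2⟩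
    exact mul_le_mul_of_nonneg_right (hanti (hmem (j + 1) hj) hx' hx.1) (hρ0 x hx')
  · exact (hint hρ (hmem (j + 1) hj) (hmem j hj.le)).const_mul _
  · exact hint (hf.mul hρ) (hmem (j + 1) hj) (hmem j hj.le)
  · have hx' : x ∈ Set.Icc a b := ⟨(hmem (j + 1) hj).1.trans hx.1, hx.2.trans (hmem j hj.le).2⟩
    exact mul_le_mul_of_nonneg_right (hanti hx' (hmem j hj.le) hx.2) (hρ0 x hx')

theorem antitoneOn_div_sub_sq {a b c : ℝ} (hc : 0 ≤ c) (hca : c < a) :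
    AntitoneOn (fun x => (c / (x - c)) ^ 2) (Set.Icc a b) := by
  intro x hx y _ hxy
  have : 0 < x - c := by linarith [hx.1]
  have : 0 < y - c := by linarith
  dsimp only
  gcongr

theorem continuousOn_div_sub_sq {a b c : ℝ} (hca : c < a) :
    ContinuousOn (fun x => (c / (x - c)) ^ 2) (Set.Icc a b) := by
  refine (ContinuousOn.div (by fun_prop) (by fun_prop) fun x hx => ?_).pow 2
  linarith [hx.1]

/-- If `∫ (c/(x-c))² ϱ_d` is bounded, then `c` stays away from the left edge, uniformly in `d`. -/
theorem exists_gap_aMP {α : ℝ} (hα : 0 < α) : ∃ δ : ℝ, 0 < δ ∧ ∀ d : ℝ, 0 < d → d < 1 →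
    α ≤ aMP d → α ≤ bMP d - aMP d → ∀ c ∈ Set.Ioo 0 (aMP d),
    ∫ x in (aMP d)..(bMP d), (c / (x - c)) ^ 2 * rhoMP d x ≤ α⁻¹ → δ ≤ aMP d - c := by
  set s : ℝ := α ^ 3 / 36 * Real.sqrt (α / 2) / (8 * Real.pi) with hs
  have hs0 : 0 < s := by positivity
  refine ⟨min (α / 4) (s ^ 2), by positivity, fun d h0 h1 ha hab c hc hF => ?_⟩
  obtain ⟨hc0, hca⟩ := hc
  by_contra! hlt
  obtain ⟨hlt1, hlt2⟩ := lt_min_iff.1 hlt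
  set δ := aMP d - c with hδ
  have hδ0 : 0 < δ := by linarith
  have hb4 := bMP_le_four h1
  have hint : IntervalIntegrable (fun x => (c / (x - c)) ^ 2 * rhoMP d x) volume
      (aMP d) (bMP d) :=
    ((continuousOn_div_sub_sq hca).mul (continuousOn_rhoMP h0 h1)).intervalIntegrable_of_Icc
      (aMP_lt_bMP h0).le
  have hsub : ∫ x in (aMP d + δ)..(aMP d + 2 * δ), (c / (x - c)) ^ 2 * rhoMP d x
      ≤ ∫ x in (aMP d)..(bMP d), (c / (x - c)) ^ 2 * rhoMP d x :=
    intervalIntegral.integral_mono_interval (by linarith) (by linarith) (by linarith)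
      (Filter.Eventually.of_forall fun x => mul_nonneg (sq_nonneg _) (rhoMP_nonneg h0 x)) hint
  have hlow : ∫ _x in (aMP d + δ)..(aMP d + 2 * δ),
      (α / 2 / (3 * δ)) ^ 2 * (1 / (8 * Real.pi) * Real.sqrt (α / 2 * δ))
      ≤ ∫ x in (aMP d + δ)..(aMP d + 2 * δ), (c / (x - c)) ^ 2 * rhoMP d x := by
    refine intervalIntegral.integral_mono_on (by linarith) (by simp) (hint.mono_set ?_)
      fun x hx => ?_
    · rw [Set.uIcc_of_le (by linarith), Set.uIcc_of_le (aMP_lt_bMP h0).le]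
      exact Set.Icc_subset_Icc (by linarith) (by linarith)
    · have hx0 : 0 < x := by linarith [hx.1]
      have hxb : x ≤ bMP d := by linarith [hx.2]
      have hxc : 0 < x - c := by linarith [hx.1]
      rw [rhoMP_of_mem ⟨by linarith [hx.1], hxb⟩]
      have e1 : α / 2 / (3 * δ) ≤ c / (x - c) :=
        div_le_div₀ hc0.le (by linarith) hxc (by linarith [hx.2])
      have e2 : 1 / (8 * Real.pi) ≤ 1 / (2 * Real.pi * d * x) := by
        apply one_div_le_one_div_of_le (by positivity)
        have : d * x ≤ 4 := by nlinarith
        nlinarith [Real.pi_pos]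
      have e3 : α / 2 * δ ≤ (bMP d - x) * (x - aMP d) :=
        mul_le_mul (by linarith [hx.2]) (by linarith [hx.1]) hδ0.le (by linarith)
      have e4 := Real.sqrt_le_sqrt e3
      gcongr
  rw [intervalIntegral.integral_const, smul_eq_mul] at hlow
  have htot := (hlow.trans hsub).trans hF
  have hsq : Real.sqrt δ < s := by
    rw [Real.sqrt_lt' hs0]; exact hlt2
  rw [Real.sqrt_mul (by positivity)] at htot
  have hr0 : 0 < Real.sqrt δ := Real.sqrt_pos.2 hδ0
  have hr : Real.sqrt δ ^ 2 = δ := Real.sq_sqrt hδ0.le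
  have e : (aMP d + 2 * δ - (aMP d + δ)) * ((α / 2 / (3 * δ)) ^ 2 *
      (1 / (8 * Real.pi) * (Real.sqrt (α / 2) * Real.sqrt δ))) = s / (α * Real.sqrt δ) := by
    rw [show aMP d + 2 * δ - (aMP d + δ) = δ by ring, hs]
    field_simp
    rw [hr]
    ring
  rw [e, div_le_iff₀ (by positivity)] at htot
  rw [inv_mul_cancel_left₀ hα.ne'] at htot
  linarith

/-- Increments of `c ↦ ∫ (c/(x-c))² ϱ_d` are at least linear. -/
theorem integral_div_sub_sq_increment {d : ℝ} (h0 : 0 < d) (h1 : d < 1) {c₀ c : ℝ} (hc₀ : 0 ≤ c₀)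
    (hle : c₀ ≤ c) (hca : c < aMP d) :
    (c - c₀) * c / 16 ≤ (∫ x in (aMP d)..(bMP d), (c / (x - c)) ^ 2 * rhoMP d x) -
      ∫ x in (aMP d)..(bMP d), (c₀ / (x - c₀)) ^ 2 * rhoMP d x := by
  have hab := (aMP_lt_bMP h0).le
  have hρ := continuousOn_rhoMP h0 h1
  have hint : ∀ t < aMP d, IntervalIntegrable (fun x => (t / (x - t)) ^ 2 * rhoMP d x) volume
      (aMP d) (bMP d) := fun t ht =>
    ((continuousOn_div_sub_sq ht).mul hρ).intervalIntegrable_of_Icc hab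
  have hρi := hρ.intervalIntegrable_of_Icc (μ := volume) hab
  rw [← intervalIntegral.integral_sub (hint c hca) (hint c₀ (by linarith))]
  calc (c - c₀) * c / 16 = ∫ x in (aMP d)..(bMP d), (c - c₀) * c / 16 * rhoMP d x := by
        rw [intervalIntegral.integral_const_mul, integral_rhoMP h0 h1, mul_one]
    _ ≤ _ := by
        refine intervalIntegral.integral_mono_on hab (hρi.const_mul _)
          ((hint c hca).sub (hint c₀ (by linarith))) fun x hx => ?_
        rw [← sub_mul]
        refine mul_le_mul_of_nonneg_right ?_ (rhoMP_nonneg h0 x)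
        have hx4 : x ≤ 4 := hx.2.trans (bMP_le_four h1)
        have hx1 : 0 < x - c := by linarith [hx.1]
        have hx2 : 0 < x - c₀ := by linarith
        have hx0 : 0 < x := by linarith
        have e1 : (c - c₀) / 4 ≤ c / (x - c) - c₀ / (x - c₀) := by
          have : c / (x - c) - c₀ / (x - c₀) = (c - c₀) * (x / (x - c)) / (x - c₀) := by
            field_simp; ring
          rw [this]
          refine div_le_div₀ ?_ ?_ hx2 (by linarith)
          · exact mul_nonneg (by linarith) (by positivity)
          · exact le_mul_of_one_le_right (by linarith) ((one_le_div hx1).2 (by linarith))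
        have e2 : c / 4 ≤ c / (x - c) + c₀ / (x - c₀) := by
          have : c / 4 ≤ c / (x - c) := div_le_div_of_nonneg_left (by linarith) hx1 (by linarith)
          have : 0 ≤ c₀ / (x - c₀) := by positivity
          linarith
        calc (c - c₀) * c / 16 = (c - c₀) / 4 * (c / 4) := by ring
          _ ≤ (c / (x - c) - c₀ / (x - c₀)) * (c / (x - c) + c₀ / (x - c₀)) :=
              mul_le_mul e1 e2 (by linarith) (le_trans (by linarith) e1)
          _ = _ := by ring

/-- The quantile discretisation at a fixed ratio `d`, with explicit error bounds. -/
theorem exists_quantile_root {d : ℝ} (h0 : 0 < d) (h1 : d < 1) {p : ℕ} (hp : 0 < p) {γ : ℕ → ℝ}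
    (hγ0 : γ 0 = bMP d) (hγp : γ p = aMP d)
    (hγ : ∀ j, 1 ≤ j → j ≤ p - 1 → γ j ∈ Set.Ioo (aMP d) (bMP d) ∧
      (∫ x in (γ j)..(bMP d), rhoMP d x) = (j : ℝ) / p)
    {c r δ : ℝ} (hr : 0 < r) (hδ : 0 < δ) (hc : 0 < c) (hcδ : δ ≤ aMP d - c)
    (hF : ∫ x in (aMP d)..(bMP d), (c / (x - c)) ^ 2 * rhoMP d x = r) :
    ∃ c₀ ∈ Set.Ioc 0 c,
      (1 / (p : ℝ)) * ∑ j ∈ Finset.Icc 1 p, (c₀ / (γ j - c₀)) ^ 2 = r ∧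
      c - c₀ ≤ 16 / δ ^ 2 / p ∧ δ * Real.sqrt r ≤ c₀ := by
  have hp' : (0 : ℝ) < p := by exact_mod_cast hp
  have hca : c < aMP d := by linarith
  have hab := aMP_lt_bMP h0
  have hmem : ∀ j ≤ p, γ j ∈ Set.Icc (aMP d) (bMP d) := by
    intro j hj
    rcases Nat.eq_zero_or_pos j with rfl | hj0
    · rw [hγ0]; exact ⟨hab.le, le_rfl⟩
    rcases hj.eq_or_lt with rfl | hjp
    · rw [hγp]; exact ⟨le_rfl, hab.le⟩
    · exact Set.Ioo_subset_Icc_self (hγ j hj0 (by omega)).1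
  have hq : ∀ j ≤ p, ∫ x in (γ j)..(bMP d), rhoMP d x = (j : ℝ) / p := by
    intro j hj
    rcases Nat.eq_zero_or_pos j with rfl | hj0
    · simp [hγ0]
    rcases hj.eq_or_lt with rfl | hjp
    · rw [hγp, integral_rhoMP h0 h1, div_self hp'.ne']
    · exact (hγ j hj0 (by omega)).2
  have hbounds := fun (t : ℝ) (ht0 : 0 ≤ t) (hta : t < aMP d) =>
    quantile_sum_bounds (continuousOn_rhoMP h0 h1) (fun x _ => rhoMP_nonneg h0 x)
      (continuousOn_div_sub_sq hta) (antitoneOn_div_sub_sq ht0 hta) hp hγ0 hγp hmem hq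
  have hshift : ∀ t : ℝ, ∑ j ∈ Finset.Icc 1 p, (t / (γ j - t)) ^ 2
      = ∑ j ∈ Finset.range p, (t / (γ (j + 1) - t)) ^ 2 := by
    intro t
    rw [Finset.range_eq_Ico, Finset.sum_Ico_add' (fun j => (t / (γ j - t)) ^ 2) 0 p 1]
    rfl
  have hGcont : ContinuousOn
      (fun t : ℝ => (1 / (p : ℝ)) * ∑ j ∈ Finset.Icc 1 p, (t / (γ j - t)) ^ 2)
      (Set.Icc 0 c) := by
    refine continuousOn_const.mul (continuousOn_finsetSum _ fun j hj => ?_)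
    refine (ContinuousOn.div (by fun_prop) (by fun_prop) fun t ht => ?_).pow 2
    have := (hmem j (Finset.mem_Icc.1 hj).2).1
    linarith [ht.2]
  have hGc := (hbounds c hc.le hca).1
  rw [← hshift, hF] at hGc
  obtain ⟨c₀, ⟨hc₀, hc₀c⟩, hG⟩ := intermediate_value_Icc hc.le hGcont
    (show r ∈ Set.Icc _ _ from ⟨by simpa using hr.le, hGc⟩)
  dsimp only at hG
  have hc₀a : c₀ < aMP d := by linarith
  have hc₀pos : 0 < c₀ := by
    rcases hc₀.eq_or_lt with h | h
    · rw [← h] at hG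
      simp at hG
      linarith
    · exact h
  have hratio : c₀ / (aMP d - c₀) ≤ c / δ := by
    gcongr; linarith
  have hsqr : (c₀ / (aMP d - c₀)) ^ 2 ≤ (c / δ) ^ 2 :=
    pow_le_pow_left₀ (div_nonneg hc₀ (by linarith)) hratio 2
  refine ⟨c₀, ⟨hc₀pos, hc₀c⟩, hG, ?_, ?_⟩
  · have hlow := (hbounds c₀ hc₀ hc₀a).2
    have htel := Finset.sum_range_sub (fun j => (c₀ / (γ j - c₀)) ^ 2) p
    rw [Finset.sum_sub_distrib, hγ0, hγp, ← hshift] at htel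
    have hinc := integral_div_sub_sq_increment h0 h1 hc₀ hc₀c hca
    rw [hF] at hinc
    have hbpos : 0 ≤ (c₀ / (bMP d - c₀)) ^ 2 := sq_nonneg _
    have hdiff : (c - c₀) * c / 16 ≤ 1 / p * (c / δ) ^ 2 := by
      calc (c - c₀) * c / 16 ≤ r - 1 / (p : ℝ) * ∑ j ∈ Finset.range p, (c₀ / (γ j - c₀)) ^ 2 := by
            linarith
        _ = 1 / p * ((c₀ / (aMP d - c₀)) ^ 2 - (c₀ / (bMP d - c₀)) ^ 2) := by
            rw [← hG, ← mul_sub, htel]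
        _ ≤ _ := by gcongr; linarith
    have hc1 : c ≤ 1 := hca.le.trans (aMP_le_one h1)
    have h2 : (c - c₀) * c ≤ 16 / δ ^ 2 / p * c * c := by
      calc (c - c₀) * c = 16 * ((c - c₀) * c / 16) := by ring
        _ ≤ 16 * (1 / p * (c / δ) ^ 2) := by gcongr
        _ = _ := by field_simp
    have h3 := le_of_mul_le_mul_right h2 hc
    exact h3.trans (mul_le_of_le_one_right (by positivity) hc1)
  · have hterm : ∀ j ∈ Finset.Icc 1 p, (c₀ / (γ j - c₀)) ^ 2 ≤ (c₀ / δ) ^ 2 := by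
      intro j hj
      have := (hmem j (Finset.mem_Icc.1 hj).2).1
      have h5 : δ ≤ γ j - c₀ := by linarith
      have : 0 < γ j - c₀ := by linarith
      gcongr
    have hs := Finset.sum_le_sum hterm
    rw [Finset.sum_const, Nat.card_Icc, nsmul_eq_mul, Nat.add_sub_cancel] at hs
    have h6 : r ≤ (c₀ / δ) ^ 2 := by
      rw [← hG]
      calc _ ≤ 1 / (p : ℝ) * (p * (c₀ / δ) ^ 2) := by gcongr
        _ = _ := by field_simp
    have h7 := Real.sqrt_le_sqrt h6
    rw [Real.sqrt_sq (by positivity), le_div_iff₀ hδ] at h7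
    linarith

/-- under Condition 3 with `0 < d₁ < 1`, for large `p` there exists
`c_{p,0} ∈ (0, c_p]` with `(1/p)·Σ_{j=1}^p (c_{p,0}/(γ_j − c_{p,0}))² = n/p` and
`|c_{p,0} − c_p| ≤ M·a_p/n` for a constant `M`; consequently
`limsup_p c_{p,0}/a_p < 1` and `c_{p,0}` is bounded below by a positive constant. -/
theorem stmt_8 (m n : ℕ → ℕ) (d₁ d₂ d₃ : ℝ)
    (hd₁ : d₁ ∈ Set.Ioo (0 : ℝ) 1) (hd₂ : 0 < d₂) (hd₃ : d₃ ∈ Set.Ioo (0 : ℝ) 1)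
    (hm : Tendsto (fun p : ℕ => (p : ℝ) / m p) atTop (nhds d₁))
    (hn : Tendsto (fun p : ℕ => (p : ℝ) / n p) atTop (nhds d₂))
    (hmn : Tendsto (fun p : ℕ => (p : ℝ) / ((m p : ℝ) + n p)) atTop (nhds d₃))
    (c : ℕ → ℝ)
    (hc : ∀ᶠ p : ℕ in atTop,
      c p ∈ Set.Ioo 0 (aMP ((p : ℝ) / m p)) ∧
      (∫ x in (aMP ((p : ℝ) / m p))..(bMP ((p : ℝ) / m p)),
          (c p / (x - c p)) ^ 2 * rhoMP ((p : ℝ) / m p) x) = (n p : ℝ) / p)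
    (γq : ℕ → ℕ → ℝ)
    (hγq : ∀ᶠ p : ℕ in atTop,
      γq p 0 = bMP ((p : ℝ) / m p) ∧ γq p p = aMP ((p : ℝ) / m p) ∧
      ∀ j, 1 ≤ j → j ≤ p - 1 →
        γq p j ∈ Set.Ioo (aMP ((p : ℝ) / m p)) (bMP ((p : ℝ) / m p)) ∧
        (∫ x in (γq p j)..(bMP ((p : ℝ) / m p)), rhoMP ((p : ℝ) / m p) x) = (j : ℝ) / p) :
    ∃ M : ℝ, ∃ c₀ : ℕ → ℝ,
      (∀ᶠ p : ℕ in atTop,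
        c₀ p ∈ Set.Ioc 0 (c p) ∧
        (1 / (p : ℝ)) * ∑ j ∈ Finset.Icc 1 p, (c₀ p / (γq p j - c₀ p)) ^ 2 = (n p : ℝ) / p ∧
        |c₀ p - c p| ≤ M * aMP ((p : ℝ) / m p) / n p) ∧
      Filter.limsup (fun p : ℕ => c₀ p / aMP ((p : ℝ) / m p)) atTop < 1 ∧
      ∃ ε : ℝ, 0 < ε ∧ ∀ᶠ p : ℕ in atTop, ε ≤ c₀ p := by
  have ha₁ : 0 < aMP d₁ := aMP_pos hd₁.2
  have hab₁ : 0 < bMP d₁ - aMP d₁ := sub_pos.2 (aMP_lt_bMP hd₁.1)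
  have hca : Continuous aMP := by unfold aMP; fun_prop
  have hcb : Continuous bMP := by unfold bMP; fun_prop
  have hta := (hca.tendsto d₁).comp hm
  have htab := ((hcb.sub hca).tendsto d₁).comp hm
  have hninv := hn.inv₀ hd₂.ne'
  have hd₂' : 0 < d₂⁻¹ := inv_pos.2 hd₂
  obtain ⟨α, hα, hα'⟩ := exists_between
    (lt_min (lt_min ha₁ hab₁) (lt_min hd₂ hd₂'))
  simp only [lt_min_iff] at hα'
  obtain ⟨⟨hα1, hα2⟩, hα3, hα4⟩ := hα'
  obtain ⟨δ, hδ, hgap⟩ := exists_gap_aMP hα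
  have main : ∀ᶠ p : ℕ in atTop, ∃ c₀ : ℝ,
      (c₀ ∈ Set.Ioc 0 (c p) ∧
        (1 / (p : ℝ)) * ∑ j ∈ Finset.Icc 1 p, (c₀ / (γq p j - c₀)) ^ 2 = (n p : ℝ) / p ∧
        |c₀ - c p| ≤ 16 / δ ^ 2 / α ^ 2 * aMP ((p : ℝ) / m p) / n p) ∧
      c₀ / aMP ((p : ℝ) / m p) ≤ 1 - δ ∧ δ * Real.sqrt α ≤ c₀ := by
    filter_upwards [hc, hγq, hm.eventually_const_lt hd₁.1, hm.eventually_lt_const hd₁.2,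
      hta.eventually_const_lt hα1, htab.eventually_const_lt hα2, hn.eventually_const_lt hα3,
      hninv.eventually_const_lt hα4, eventually_gt_atTop 0]
      with p hcp hγp h0 h1 ha hab hpn hnp hp
    obtain ⟨⟨hc0, hca⟩, hF⟩ := hcp
    obtain ⟨hγ0, hγp, hγ⟩ := hγp
    simp only [Function.comp_apply] at ha hab
    rw [inv_div] at hnp
    have hp' : (0 : ℝ) < p := by exact_mod_cast hp
    have hn0 : (0 : ℝ) < n p := by
      by_contra! h
      have : (n p : ℝ) = 0 := le_antisymm h (Nat.cast_nonneg _)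
      rw [this, div_zero] at hpn
      linarith
    have hcδ := hgap _ h0 h1 ha.le hab.le (c p) ⟨hc0, hca⟩ (by
      rw [hF, ← inv_div]
      exact inv_anti₀ hα hpn.le)
    obtain ⟨c₀, hmem, hG, hdist, hlow⟩ := exists_quantile_root h0 h1 hp hγ0 hγp hγ
      (hα.trans hnp) hδ hc0 hcδ hF
    refine ⟨c₀, ⟨hmem, hG, ?_⟩, ?_, le_trans ?_ hlow⟩
    · rw [abs_sub_comm, abs_of_nonneg (by linarith [hmem.2])]
      refine hdist.trans ?_
      rw [lt_div_iff₀ hn0] at hpn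
      have h2 : α ^ 2 * n p ≤ aMP ((p : ℝ) / m p) * p := by
        nlinarith
      rw [div_mul_eq_mul_div (16 / δ ^ 2), div_div (_ * _), div_le_div_iff₀ hp' (by positivity)]
      calc 16 / δ ^ 2 * (α ^ 2 * n p) ≤ 16 / δ ^ 2 * (aMP ((p : ℝ) / m p) * p) := by gcongr
        _ = _ := by ring
    · have ha1 := aMP_le_one h1
      have ha0 := aMP_pos h1
      rw [div_le_iff₀ ha0]
      nlinarith [hmem.2]
    · gcongr
  obtain ⟨c₀, hc₀⟩ := main.choice
  refine ⟨16 / δ ^ 2 / α ^ 2, c₀, hc₀.mono fun p h => h.1, ?_, δ * Real.sqrt α, by positivity,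
    hc₀.mono fun p h => h.2.2⟩
  refine lt_of_le_of_lt (b := 1 - δ) (limsup_le_of_le ?_ (hc₀.mono fun p h => h.2.1))
    (by linarith)
  refine IsBoundedUnder.isCoboundedUnder_le ⟨0, eventually_map.2 (hc₀.mono fun p h => ?_)⟩
  exact div_nonneg h.1.1.1.le (sq_nonneg _)
end

section
/- Under Condition 3 with 0 < d₁ < 1, there is a constant M such that for all sufficiently large p: |μ_p − μ_{p,0}| ≤ M/p and |1/σ_p³ − 1/σ_{p,0}³| ≤ M/p; consequently n^{2/3}·|μ_p − μ_{p,0}| → 0 and σ_p/σ_{p,0} → 1 as p → ∞. -/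
open MeasureTheory Filter

namespace MarchenkoPastur

/-! ### Quantile Riemann sums -/

theorem quantile_antitone {a b : ℝ} {ρ : ℝ → ℝ} (hρc : ContinuousOn ρ (Set.Icc a b))
    (hρ0 : ∀ x ∈ Set.Icc a b, 0 ≤ ρ x) {p : ℕ} (hp : 0 < p) {γ : ℕ → ℝ}
    (hγ : ∀ j ≤ p, γ j ∈ Set.Icc a b) (hint : ∀ j ≤ p, ∫ x in (γ j)..b, ρ x = (j : ℝ) / p)
    {j : ℕ} (hj : j < p) : γ (j + 1) ≤ γ j := by
  by_contra! hlt
  have hp' : (0 : ℝ) < p := by exact_mod_cast hp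
  have h1 := hγ j hj.le
  have h2 := hγ (j + 1) hj
  have hle : ∫ x in (γ (j + 1))..b, ρ x ≤ ∫ x in (γ j)..b, ρ x := by
    apply intervalIntegral.integral_mono_interval hlt.le h2.2 le_rfl
    · refine (ae_restrict_iff' measurableSet_Ioc).2 (Eventually.of_forall fun x hx => ?_)
      exact hρ0 x ⟨h1.1.trans hx.1.le, hx.2⟩
    · apply ContinuousOn.intervalIntegrable
      rw [Set.uIcc_of_le h1.2]
      exact hρc.mono (Set.Icc_subset_Icc_left h1.1)
  rw [hint _ hj, hint _ hj.le] at hle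
  have := (div_le_div_iff_of_pos_right hp').1 hle
  push_cast at this
  linarith

/-- The quantile Riemann sum of an antitone function is within `(f a - f b) / p` of its
integral. -/
theorem abs_integral_sub_quantile_sum_le {a b : ℝ} (hab : a ≤ b) {ρ f : ℝ → ℝ}
    (hρc : ContinuousOn ρ (Set.Icc a b)) (hρ0 : ∀ x ∈ Set.Icc a b, 0 ≤ ρ x)
    (hfc : ContinuousOn f (Set.Icc a b)) (hf : AntitoneOn f (Set.Icc a b))
    {p : ℕ} (hp : 0 < p) {γ : ℕ → ℝ} (hγ0 : γ 0 = b) (hγp : γ p = a)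
    (hγ : ∀ j ≤ p, γ j ∈ Set.Icc a b) (hint : ∀ j ≤ p, ∫ x in (γ j)..b, ρ x = (j : ℝ) / p) :
    |(∫ x in a..b, f x * ρ x) - (1 / (p : ℝ)) * ∑ j ∈ Finset.Icc 1 p, f (γ j)|
      ≤ (f a - f b) / p := by
  have hp' : (0 : ℝ) < p := by exact_mod_cast hp
  have hii : ∀ g : ℝ → ℝ, ContinuousOn g (Set.Icc a b) → ∀ y ∈ Set.Icc a b, ∀ z ∈ Set.Icc a b,
      IntervalIntegrable g volume y z := fun g hg y hy z hz =>
    (hg.mono (Set.uIcc_subset_Icc hy hz)).intervalIntegrable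
  have hbm : b ∈ Set.Icc a b := Set.right_mem_Icc.2 hab
  have hpiece : ∀ j < p, ∫ x in (γ (j + 1))..(γ j), ρ x = 1 / p := by
    intro j hj
    have h := intervalIntegral.integral_add_adjacent_intervals
      (hii ρ hρc _ (hγ (j + 1) hj) _ (hγ j hj.le)) (hii ρ hρc _ (hγ j hj.le) _ hbm)
    rw [hint _ hj, hint _ hj.le] at h
    push_cast at h
    rw [add_div] at h
    linarith
  have hmono : ∀ j < p, γ (j + 1) ≤ γ j := fun j hj =>
    quantile_antitone hρc hρ0 hp hγ hint hj
  have hfρ : ContinuousOn (fun x => f x * ρ x) (Set.Icc a b) := hfc.mul hρc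
  have hup : ∀ j < p, ∫ x in (γ (j + 1))..(γ j), f x * ρ x ≤ f (γ (j + 1)) * (1 / p) := by
    intro j hj
    rw [← hpiece j hj, ← intervalIntegral.integral_const_mul]
    refine intervalIntegral.integral_mono_on (hmono j hj)
      (hii _ hfρ _ (hγ (j + 1) hj) _ (hγ j hj.le))
      ((hii ρ hρc _ (hγ (j + 1) hj) _ (hγ j hj.le)).const_mul _) fun x hx => ?_
    have hx' : x ∈ Set.Icc a b := ⟨(hγ (j + 1) hj).1.trans hx.1, hx.2.trans (hγ j hj.le).2⟩
    exact mul_le_mul_of_nonneg_right (hf (hγ (j + 1) hj) hx' hx.1) (hρ0 x hx')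
  have hlow : ∀ j < p, f (γ j) * (1 / p) ≤ ∫ x in (γ (j + 1))..(γ j), f x * ρ x := by
    intro j hj
    rw [← hpiece j hj, ← intervalIntegral.integral_const_mul]
    refine intervalIntegral.integral_mono_on (hmono j hj)
      ((hii ρ hρc _ (hγ (j + 1) hj) _ (hγ j hj.le)).const_mul _)
      (hii _ hfρ _ (hγ (j + 1) hj) _ (hγ j hj.le)) fun x hx => ?_
    have hx' : x ∈ Set.Icc a b := ⟨(hγ (j + 1) hj).1.trans hx.1, hx.2.trans (hγ j hj.le).2⟩
    exact mul_le_mul_of_nonneg_right (hf hx' (hγ j hj.le) hx.2) (hρ0 x hx')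
  have hsum : ∑ j ∈ Finset.range p, ∫ x in (γ (j + 1))..(γ j), f x * ρ x
      = ∫ x in a..b, f x * ρ x := by
    have h := intervalIntegral.sum_integral_adjacent_intervals (a := γ) (n := p)
      (f := fun x => f x * ρ x) (μ := volume)
      (fun j hj => hii _ hfρ _ (hγ j hj.le) _ (hγ (j + 1) hj))
    rw [hγ0, hγp] at h
    rw [intervalIntegral.integral_symm, ← h, ← Finset.sum_neg_distrib]
    exact Finset.sum_congr rfl fun j _ => intervalIntegral.integral_symm _ _
  have hshift : ∑ j ∈ Finset.Icc 1 p, f (γ j) = ∑ j ∈ Finset.range p, f (γ (j + 1)) := by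
    rw [← Finset.Ico_add_one_right_eq_Icc, Finset.sum_Ico_eq_sum_range]
    simp [add_comm]
  have htel : ∑ j ∈ Finset.range p, f (γ (j + 1)) - ∑ j ∈ Finset.range p, f (γ j)
      = f a - f b := by
    rw [← Finset.sum_sub_distrib, Finset.sum_range_sub (fun j => f (γ j)), hγ0, hγp]
  have h1 := Finset.sum_le_sum fun j hj => hup j (Finset.mem_range.1 hj)
  have h2 := Finset.sum_le_sum fun j hj => hlow j (Finset.mem_range.1 hj)
  rw [hsum, ← Finset.sum_mul] at h1 h2
  rw [hshift, ← htel, abs_le, sub_div]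
  constructor <;> simp only [mul_one_div, one_div_mul_eq_div] at * <;> linarith

/-! ### Stability of the critical point -/

theorem continuousOn_inv_sub_pow {a b c : ℝ} (hc : c < a) (k : ℕ) :
    ContinuousOn (fun x => (1 / (x - c)) ^ k) (Set.Icc a b) := by
  refine (ContinuousOn.div continuousOn_const (by fun_prop) fun x hx => ?_).pow k
  have := hx.1
  exact (by linarith : 0 < x - c).ne'

theorem antitoneOn_inv_sub_pow {a b c : ℝ} (hc : c < a) (k : ℕ) :
    AntitoneOn (fun x => (1 / (x - c)) ^ k) (Set.Icc a b) := by
  intro x hx y hy hxy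
  have h1 := hx.1
  have h2 : 0 < x - c := by linarith
  have h3 : 0 < y - c := by linarith
  dsimp only
  gcongr

theorem inv_sub_le {a c x δ : ℝ} (hδ : 0 < δ) (hac : δ ≤ a - c) (hx : a ≤ x) :
    1 / (x - c) ≤ 1 / δ :=
  one_div_le_one_div_of_le hδ (by linarith)

theorem integral_const_mul_inv_pow (a b c : ℝ) (ρ : ℝ → ℝ) (k : ℕ) :
    ∫ x in a..b, (c / (x - c)) ^ k * ρ x = c ^ k * ∫ x in a..b, (1 / (x - c)) ^ k * ρ x := by
  rw [← intervalIntegral.integral_const_mul]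
  congr 1
  ext x
  rw [← mul_assoc, ← mul_pow, mul_one_div]

theorem sum_const_mul_inv_pow (s : Finset ℕ) (c : ℝ) (γ : ℕ → ℝ) (k : ℕ) :
    ∑ j ∈ s, (c / (γ j - c)) ^ k = c ^ k * ∑ j ∈ s, (1 / (γ j - c)) ^ k := by
  rw [Finset.mul_sum]
  refine Finset.sum_congr rfl fun j _ => ?_
  rw [← mul_pow, mul_one_div]

/-- The integral of `(1 / (x - c)) ^ k` against a probability density is Lipschitz in `c` away
from the left edge. -/
theorem abs_integral_inv_sub_pow_sub_le {a b c c₀ δ : ℝ} (hab : a ≤ b) {ρ : ℝ → ℝ}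
    (hρc : ContinuousOn ρ (Set.Icc a b)) (hρ0 : ∀ x ∈ Set.Icc a b, 0 ≤ ρ x)
    (hρ1 : ∫ x in a..b, ρ x = 1) (hδ : 0 < δ) (hcc : c₀ ≤ c) (hac : δ ≤ a - c) (k : ℕ) :
    |(∫ x in a..b, (1 / (x - c)) ^ k * ρ x) - ∫ x in a..b, (1 / (x - c₀)) ^ k * ρ x|
      ≤ (c - c₀) * (1 / δ) ^ 2 * k * (1 / δ) ^ (k - 1) := by
  have hii : ∀ e, e < a → IntervalIntegrable (fun x => (1 / (x - e)) ^ k * ρ x) volume a b := by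
    intro e he
    apply ContinuousOn.intervalIntegrable
    rw [Set.uIcc_of_le hab]
    exact (continuousOn_inv_sub_pow he k).mul hρc
  have hρi : IntervalIntegrable ρ volume a b := by
    apply ContinuousOn.intervalIntegrable
    rwa [Set.uIcc_of_le hab]
  rw [← intervalIntegral.integral_sub (hii c (by linarith)) (hii c₀ (by linarith))]
  set L := (c - c₀) * (1 / δ) ^ 2 * k * (1 / δ) ^ (k - 1) with hL
  have hbound : ∀ x ∈ Set.Icc a b,
      ‖(1 / (x - c)) ^ k * ρ x - (1 / (x - c₀)) ^ k * ρ x‖ ≤ L * ρ x := by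
    intro x hx
    have hρx := hρ0 x hx
    have h1 : 0 < x - c := by linarith [hx.1]
    have h2 : 0 < x - c₀ := by linarith [hx.1]
    have hv := inv_sub_le hδ hac hx.1
    have hv0 := inv_sub_le hδ (hac.trans (by linarith : a - c ≤ a - c₀)) hx.1
    rw [← sub_mul, Real.norm_eq_abs, abs_mul, abs_of_nonneg hρx]
    refine mul_le_mul_of_nonneg_right ((abs_pow_sub_pow_le _ _ k).trans ?_) hρx
    have hdiff : 1 / (x - c) - 1 / (x - c₀) = (c - c₀) * (1 / (x - c) * (1 / (x - c₀))) := by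
      field_simp
      ring
    have hmax : max |1 / (x - c)| |1 / (x - c₀)| ≤ 1 / δ := by
      rw [abs_of_pos (by positivity), abs_of_pos (by positivity)]
      exact max_le hv hv0
    have hcc' : 0 ≤ c - c₀ := by linarith
    rw [hdiff, abs_of_nonneg (by positivity), hL, sq]
    gcongr
  calc |∫ x in a..b, ((1 / (x - c)) ^ k * ρ x - (1 / (x - c₀)) ^ k * ρ x)|
      ≤ ∫ x in a..b, L * ρ x := by
        rw [← Real.norm_eq_abs]
        refine intervalIntegral.norm_integral_le_of_norm_le hab
          (Eventually.of_forall fun x hx => hbound x ⟨hx.1.le, hx.2⟩) (hρi.const_mul L)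
    _ = L := by rw [intervalIntegral.integral_const_mul, hρ1, mul_one]

/-- If `c` and `c₀` solve the continuous and the quantile critical equation, then the
corresponding centering and scaling functionals of order `k` differ by `O(1 / p)`. -/
theorem abs_functional_sub_le {a b c c₀ δ ν R : ℝ} (hab : a ≤ b) (ha1 : a ≤ 1) {ρ : ℝ → ℝ}
    (hρc : ContinuousOn ρ (Set.Icc a b)) (hρ0 : ∀ x ∈ Set.Icc a b, 0 ≤ ρ x)
    (hρ1 : ∫ x in a..b, ρ x = 1) (hδ : 0 < δ) (hc0 : 0 < c₀) (hcc : c₀ ≤ c) (hac : δ ≤ a - c)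
    {p : ℕ} (hp : 0 < p) {γ : ℕ → ℝ} (hγ0 : γ 0 = b) (hγp : γ p = a)
    (hγ : ∀ j ≤ p, γ j ∈ Set.Icc a b) (hint : ∀ j ≤ p, ∫ x in (γ j)..b, ρ x = (j : ℝ) / p)
    (hν : 0 < ν) (hνR : 1 / ν ≤ R)
    (hc : ∫ x in a..b, (c / (x - c)) ^ 2 * ρ x = ν)
    (hc₀ : (1 / (p : ℝ)) * ∑ j ∈ Finset.Icc 1 p, (c₀ / (γ j - c₀)) ^ 2 = ν) (k : ℕ) :
    |(1 / c ^ k) * (1 + 1 / ν * ∫ x in a..b, (c / (x - c)) ^ k * ρ x) -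
      (1 / c₀ ^ k) * (1 + 1 / ν * ((1 / (p : ℝ)) * ∑ j ∈ Finset.Icc 1 p, (c₀ / (γ j - c₀)) ^ k))|
    ≤ ((1 / δ) ^ 2 * R * k * ((1 / δ) ^ 2 * R) ^ (k - 1) +
        R * ((1 / δ) ^ 2 * R * (1 / δ) ^ 2 * k * (1 / δ) ^ (k - 1) + (1 / δ) ^ k)) / p := by
  have hp' : (0 : ℝ) < p := by exact_mod_cast hp
  have hcpos : 0 < c := hc0.trans_le hcc
  have hc0a : c₀ < a := by linarith
  have hR : 0 < R := lt_of_lt_of_le (by positivity) hνR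
  have hac0 : δ ≤ a - c₀ := by linarith
  have hriem : ∀ k : ℕ, |(∫ x in a..b, (1 / (x - c₀)) ^ k * ρ x) -
      (1 / (p : ℝ)) * ∑ j ∈ Finset.Icc 1 p, (1 / (γ j - c₀)) ^ k| ≤ (1 / δ) ^ k / p := by
    intro k
    refine (abs_integral_sub_quantile_sum_le hab hρc hρ0 (continuousOn_inv_sub_pow hc0a k)
      (antitoneOn_inv_sub_pow hc0a k) hp hγ0 hγp hγ hint).trans ?_
    have h1 : 0 < a - c₀ := by linarith
    have h2 : 0 < b - c₀ := by linarith
    have h3 : 0 ≤ (1 / (b - c₀)) ^ k := by positivity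
    have h4 : (1 / (a - c₀)) ^ k ≤ (1 / δ) ^ k := by
      have := inv_sub_le hδ hac0 le_rfl
      gcongr
    gcongr
    linarith
  rw [integral_const_mul_inv_pow] at hc
  rw [sum_const_mul_inv_pow] at hc₀
  set u := 1 / c with hu
  set u₀ := 1 / c₀ with hu₀
  have hu1 : 1 ≤ u := by rw [hu, le_div_iff₀ hcpos]; linarith
  have huu : u ≤ u₀ := one_div_le_one_div_of_le hc0 hcc
  have hIc : ∫ x in a..b, (1 / (x - c)) ^ 2 * ρ x = ν * u ^ 2 := by
    rw [← hc, hu]; field_simp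
  have hSc : (1 / (p : ℝ)) * ∑ j ∈ Finset.Icc 1 p, (1 / (γ j - c₀)) ^ 2 = ν * u₀ ^ 2 := by
    rw [← hc₀, hu₀]; field_simp
  have hSle : (1 / (p : ℝ)) * ∑ j ∈ Finset.Icc 1 p, (1 / (γ j - c₀)) ^ 2 ≤ (1 / δ) ^ 2 := by
    have : ∑ j ∈ Finset.Icc 1 p, (1 / (γ j - c₀)) ^ 2 ≤ ∑ j ∈ Finset.Icc 1 p, (1 / δ) ^ 2 := by
      refine Finset.sum_le_sum fun j hj => ?_
      have hj' := (hγ j (Finset.mem_Icc.1 hj).2).1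
      have := inv_sub_le hδ hac0 hj'
      have h1 : 0 < γ j - c₀ := by linarith
      gcongr
    rw [Finset.sum_const, Nat.card_Icc, nsmul_eq_mul] at this
    simp only [add_tsub_cancel_right] at this
    rw [one_div_mul_eq_div, div_le_iff₀ hp']
    linarith
  have hu0R : u₀ ≤ (1 / δ) ^ 2 * R := by
    have h1 : u₀ ^ 2 ≤ (1 / δ) ^ 2 * (1 / ν) := by
      rw [mul_one_div, le_div_iff₀ hν]; linarith
    have h2 : (1 / δ) ^ 2 * (1 / ν) ≤ (1 / δ) ^ 2 * R := by gcongr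
    nlinarith
  have hmonoI : ∫ x in a..b, (1 / (x - c₀)) ^ 2 * ρ x ≤ ∫ x in a..b, (1 / (x - c)) ^ 2 * ρ x := by
    have hii : ∀ e, e < a →
        IntervalIntegrable (fun x => (1 / (x - e)) ^ 2 * ρ x) volume a b := by
      intro e he
      apply ContinuousOn.intervalIntegrable
      rw [Set.uIcc_of_le hab]
      exact (continuousOn_inv_sub_pow he 2).mul hρc
    refine intervalIntegral.integral_mono_on hab (hii _ hc0a) (hii _ (by linarith)) fun x hx => ?_
    have h1 : 0 < x - c := by linarith [hx.1]
    have h2 : 0 < x - c₀ := by linarith [hx.1]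
    have := hρ0 x hx
    gcongr
  have hsq : u₀ ^ 2 - u ^ 2 ≤ (1 / δ) ^ 2 * R / p := by
    have h1 := (abs_le.1 (hriem 2)).1
    rw [hIc] at hmonoI
    rw [hSc] at h1
    have h2 : u₀ ^ 2 - u ^ 2 ≤ (1 / δ) ^ 2 / p * (1 / ν) := by
      rw [mul_one_div, le_div_iff₀ hν]; linarith
    have h3 : (1 / δ) ^ 2 / p * (1 / ν) ≤ (1 / δ) ^ 2 / p * R := by gcongr
    calc _ ≤ _ := h2.trans h3
      _ = _ := by ring
  have hud : u₀ - u ≤ (1 / δ) ^ 2 * R / p := by nlinarith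
  have hcd : c - c₀ ≤ (1 / δ) ^ 2 * R / p := by
    refine le_trans ?_ hud
    have h1 : u₀ - u = (c - c₀) * (u * u₀) := by rw [hu, hu₀]; field_simp
    have h2 : 1 ≤ u * u₀ := by nlinarith
    rw [h1]
    exact le_mul_of_one_le_right (by linarith) h2
  have hupow : |u ^ k - u₀ ^ k| ≤ (1 / δ) ^ 2 * R / p * k * ((1 / δ) ^ 2 * R) ^ (k - 1) := by
    refine (abs_pow_sub_pow_le _ _ k).trans ?_
    have hmax : max |u| |u₀| ≤ (1 / δ) ^ 2 * R := by
      rw [abs_of_pos (by linarith), abs_of_pos (by linarith)]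
      exact max_le (huu.trans hu0R) hu0R
    have habs : |u - u₀| ≤ (1 / δ) ^ 2 * R / p := by
      rw [abs_sub_comm, abs_of_nonneg (by linarith)]; exact hud
    gcongr
  have hlip := abs_integral_inv_sub_pow_sub_le hab hρc hρ0 hρ1 hδ hcc hac k
  have hlip' : (c - c₀) * (1 / δ) ^ 2 * k * (1 / δ) ^ (k - 1) ≤
      (1 / δ) ^ 2 * R / p * (1 / δ) ^ 2 * k * (1 / δ) ^ (k - 1) := by gcongr
  have hrk := hriem k
  rw [integral_const_mul_inv_pow, sum_const_mul_inv_pow]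
  set I := ∫ x in a..b, (1 / (x - c)) ^ k * ρ x
  set I₀ := ∫ x in a..b, (1 / (x - c₀)) ^ k * ρ x
  set S := ∑ j ∈ Finset.Icc 1 p, (1 / (γ j - c₀)) ^ k
  have hrw : (1 / c ^ k) * (1 + 1 / ν * (c ^ k * I)) -
      (1 / c₀ ^ k) * (1 + 1 / ν * ((1 / (p : ℝ)) * (c₀ ^ k * S))) =
      (u ^ k - u₀ ^ k) + 1 / ν * ((I - I₀) + (I₀ - 1 / (p : ℝ) * S)) := by
    rw [hu, hu₀, div_pow, div_pow, one_pow]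
    field_simp
    ring
  rw [hrw]
  have hIS : |(I - I₀) + (I₀ - 1 / (p : ℝ) * S)| ≤
      (1 / δ) ^ 2 * R / p * (1 / δ) ^ 2 * k * (1 / δ) ^ (k - 1) + (1 / δ) ^ k / p :=
    (abs_add_le _ _).trans (add_le_add (hlip.trans hlip') hrk)
  calc _ ≤ |u ^ k - u₀ ^ k| + |1 / ν * ((I - I₀) + (I₀ - 1 / (p : ℝ) * S))| := abs_add_le _ _
    _ = |u ^ k - u₀ ^ k| + 1 / ν * |(I - I₀) + (I₀ - 1 / (p : ℝ) * S)| := by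
        rw [abs_mul, abs_of_pos (show 0 < 1 / ν by positivity)]
    _ ≤ (1 / δ) ^ 2 * R / p * k * ((1 / δ) ^ 2 * R) ^ (k - 1) + R *
        ((1 / δ) ^ 2 * R / p * (1 / δ) ^ 2 * k * (1 / δ) ^ (k - 1) + (1 / δ) ^ k / p) := by
        gcongr
    _ = _ := by ring

/-! ### The Marchenko–Pastur density -/

theorem sqrt_lt_one {d : ℝ} (hd1 : d < 1) : Real.sqrt d < 1 :=
  (Real.sqrt_lt_sqrt_iff_of_pos one_pos).2 hd1 |>.trans_eq Real.sqrt_one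

theorem aMP_pos {d : ℝ} (hd1 : d < 1) : 0 < aMP d := by
  have : Real.sqrt d < 1 := sqrt_lt_one hd1
  exact pow_pos (by linarith) 2

theorem aMP_le_one {d : ℝ} (hd1 : d < 1) : aMP d ≤ 1 := by
  have : Real.sqrt d < 1 := sqrt_lt_one hd1
  unfold aMP
  nlinarith [Real.sqrt_nonneg d]

theorem bMP_le_four {d : ℝ} (hd1 : d < 1) : bMP d ≤ 4 := by
  have : Real.sqrt d < 1 := sqrt_lt_one hd1
  unfold bMP
  nlinarith [Real.sqrt_nonneg d]

theorem bMP_sub_aMP (d : ℝ) : bMP d - aMP d = 4 * Real.sqrt d := by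
  unfold aMP bMP
  ring

theorem aMP_lt_bMP {d : ℝ} (hd0 : 0 < d) : aMP d < bMP d := by
  have h := Real.sqrt_pos.2 hd0
  linarith [bMP_sub_aMP d]

theorem rhoMP_eq {d x : ℝ} (hx : x ∈ Set.Icc (aMP d) (bMP d)) :
    rhoMP d x = (1 / (2 * Real.pi * d * x)) * Real.sqrt ((bMP d - x) * (x - aMP d)) :=
  if_pos hx

theorem rhoMP_nonneg {d x : ℝ} (hd0 : 0 < d) (hd1 : d < 1)
    (hx : x ∈ Set.Icc (aMP d) (bMP d)) : 0 ≤ rhoMP d x := by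
  have := (aMP_pos hd1).trans_le hx.1
  rw [rhoMP_eq hx]
  positivity

theorem continuousOn_rhoMP {d : ℝ} (hd0 : 0 < d) (hd1 : d < 1) :
    ContinuousOn (rhoMP d) (Set.Icc (aMP d) (bMP d)) := by
  refine ContinuousOn.congr (f := fun x =>
    (1 / (2 * Real.pi * d * x)) * Real.sqrt ((bMP d - x) * (x - aMP d))) ?_ fun x hx => rhoMP_eq hx
  refine (ContinuousOn.div continuousOn_const (by fun_prop) fun x hx => ?_).mul
    (Continuous.continuousOn (by fun_prop))
  have := (aMP_pos hd1).trans_le hx.1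
  positivity

/-- An antiderivative of `√((t² - x)(x - s²)) / x` on `(s², t²)`. -/
theorem hasDerivAt_sqrt_div {s t x : ℝ} (hs : 0 < s) (hst : s < t)
    (hx : x ∈ Set.Ioo (s ^ 2) (t ^ 2)) :
    HasDerivAt (fun y => Real.sqrt ((t ^ 2 - y) * (y - s ^ 2)) +
        (s ^ 2 + t ^ 2) / 2 * Real.arcsin ((2 * y - s ^ 2 - t ^ 2) / (t ^ 2 - s ^ 2)) -
        s * t * Real.arcsin (((s ^ 2 + t ^ 2) * y - 2 * s ^ 2 * t ^ 2) / (y * (t ^ 2 - s ^ 2))))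
      (Real.sqrt ((t ^ 2 - x) * (x - s ^ 2)) / x) x := by
  have ht : 0 < t := hs.trans hst
  have hA : 0 < x - s ^ 2 := sub_pos.2 hx.1
  have hB : 0 < t ^ 2 - x := sub_pos.2 hx.2
  have hx0 : 0 < x := by have := sq_pos_of_pos hs; linarith
  have hD : 0 < t ^ 2 - s ^ 2 := by linarith
  have hq : 0 < (t ^ 2 - x) * (x - s ^ 2) := mul_pos hB hA
  set r := Real.sqrt ((t ^ 2 - x) * (x - s ^ 2)) with hr
  have hrpos : 0 < r := Real.sqrt_pos.2 hq
  have hr2 : r ^ 2 = (t ^ 2 - x) * (x - s ^ 2) := Real.sq_sqrt hq.le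
  have h1 : HasDerivAt (fun y => Real.sqrt ((t ^ 2 - y) * (y - s ^ 2)))
      ((s ^ 2 + t ^ 2 - 2 * x) / (2 * r)) x := by
    have : HasDerivAt (fun y => (t ^ 2 - y) * (y - s ^ 2)) (s ^ 2 + t ^ 2 - 2 * x) x := by
      refine (((hasDerivAt_id' x).const_sub (t ^ 2)).mul
        ((hasDerivAt_id' x).sub_const (s ^ 2))).congr_deriv ?_
      ring
    exact this.sqrt hq.ne'
  have hv : 1 - ((2 * x - s ^ 2 - t ^ 2) / (t ^ 2 - s ^ 2)) ^ 2 = (2 * r / (t ^ 2 - s ^ 2)) ^ 2 := by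
    rw [div_pow, div_pow, mul_pow, hr2]
    field_simp
    ring
  have hw : 1 - (((s ^ 2 + t ^ 2) * x - 2 * s ^ 2 * t ^ 2) / (x * (t ^ 2 - s ^ 2))) ^ 2 =
      (2 * s * t * r / (x * (t ^ 2 - s ^ 2))) ^ 2 := by
    rw [div_pow, div_pow, mul_pow _ r, hr2]
    field_simp
    ring
  have hne : ∀ z y : ℝ, 0 < y → 1 - z ^ 2 = y ^ 2 → z ≠ -1 ∧ z ≠ 1 := by
    intro z y hy h
    constructor <;> rintro rfl <;> norm_num at h <;> exact (sq_pos_of_pos hy).ne h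
  have hyv : 0 < 2 * r / (t ^ 2 - s ^ 2) := by positivity
  have hyw : 0 < 2 * s * t * r / (x * (t ^ 2 - s ^ 2)) := by positivity
  have h2 : HasDerivAt (fun y => Real.arcsin ((2 * y - s ^ 2 - t ^ 2) / (t ^ 2 - s ^ 2)))
      (1 / r) x := by
    have hin : HasDerivAt (fun y => (2 * y - s ^ 2 - t ^ 2) / (t ^ 2 - s ^ 2))
        (2 / (t ^ 2 - s ^ 2)) x := by
      simpa using ((((hasDerivAt_id' x).const_mul 2).sub_const (s ^ 2)).sub_const
        (t ^ 2)).div_const (t ^ 2 - s ^ 2)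
    have hn := hne _ _ hyv hv
    have h := (Real.hasDerivAt_arcsin hn.1 hn.2).comp x hin
    rw [hv, Real.sqrt_sq hyv.le] at h
    refine h.congr_deriv ?_
    field_simp
  have h3 : HasDerivAt (fun y => Real.arcsin
      (((s ^ 2 + t ^ 2) * y - 2 * s ^ 2 * t ^ 2) / (y * (t ^ 2 - s ^ 2)))) (s * t / (x * r)) x := by
    have hin : HasDerivAt
        (fun y => ((s ^ 2 + t ^ 2) * y - 2 * s ^ 2 * t ^ 2) / (y * (t ^ 2 - s ^ 2)))
        (2 * s ^ 2 * t ^ 2 / (x ^ 2 * (t ^ 2 - s ^ 2))) x := by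
      refine ((((hasDerivAt_id' x).const_mul (s ^ 2 + t ^ 2)).sub_const
        (2 * s ^ 2 * t ^ 2)).div ((hasDerivAt_id' x).mul_const (t ^ 2 - s ^ 2))
        (mul_pos hx0 hD).ne').congr_deriv ?_
      field_simp
      ring
    have hn := hne _ _ hyw hw
    have h := (Real.hasDerivAt_arcsin hn.1 hn.2).comp x hin
    rw [hw, Real.sqrt_sq hyw.le] at h
    refine h.congr_deriv ?_
    field_simp
  refine ((h1.add (h2.const_mul ((s ^ 2 + t ^ 2) / 2))).sub (h3.const_mul (s * t))).congr_deriv ?_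
  field_simp
  rw [hr2]
  ring

theorem integral_sqrt_div {s t : ℝ} (hs : 0 < s) (hst : s < t) :
    ∫ x in (s ^ 2)..(t ^ 2), Real.sqrt ((t ^ 2 - x) * (x - s ^ 2)) / x =
      Real.pi / 2 * (t - s) ^ 2 := by
  have ht : 0 < t := hs.trans hst
  have hlt : s ^ 2 < t ^ 2 := by gcongr
  have hD : t ^ 2 - s ^ 2 ≠ 0 := (sub_pos.2 hlt).ne'
  have hpos : ∀ x ∈ Set.Icc (s ^ 2) (t ^ 2), x ≠ 0 := fun x hx =>
    ((sq_pos_of_pos hs).trans_le hx.1).ne'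
  rw [intervalIntegral.integral_eq_sub_of_hasDerivAt_of_le hlt.le _
    (fun x hx => hasDerivAt_sqrt_div hs hst hx)]
  · have e1 : (2 * t ^ 2 - s ^ 2 - t ^ 2) / (t ^ 2 - s ^ 2) = 1 := by
      rw [div_eq_one_iff_eq hD]; ring
    have e2 : ((s ^ 2 + t ^ 2) * t ^ 2 - 2 * s ^ 2 * t ^ 2) / (t ^ 2 * (t ^ 2 - s ^ 2)) = 1 := by
      rw [div_eq_one_iff_eq (by positivity)]; ring
    have e3 : (2 * s ^ 2 - s ^ 2 - t ^ 2) / (t ^ 2 - s ^ 2) = -1 := by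
      rw [div_eq_iff hD]; ring
    have e4 : ((s ^ 2 + t ^ 2) * s ^ 2 - 2 * s ^ 2 * t ^ 2) / (s ^ 2 * (t ^ 2 - s ^ 2)) = -1 := by
      rw [div_eq_iff (by positivity)]; ring
    rw [e1, e2, e3, e4]
    simp only [sub_self, zero_mul, mul_zero, Real.sqrt_zero, Real.arcsin_one, Real.arcsin_neg_one]
    ring
  · apply ContinuousOn.intervalIntegrable
    rw [Set.uIcc_of_le hlt.le]
    exact ContinuousOn.div (Continuous.continuousOn (by fun_prop)) continuousOn_id hpos
  · have h1 : Continuous fun y => Real.sqrt ((t ^ 2 - y) * (y - s ^ 2)) := by fun_prop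
    have h2 : Continuous fun y => Real.arcsin ((2 * y - s ^ 2 - t ^ 2) / (t ^ 2 - s ^ 2)) :=
      Real.continuous_arcsin.comp (by fun_prop)
    have h3 : ContinuousOn (fun y => Real.arcsin
        (((s ^ 2 + t ^ 2) * y - 2 * s ^ 2 * t ^ 2) / (y * (t ^ 2 - s ^ 2))))
        (Set.Icc (s ^ 2) (t ^ 2)) :=
      Real.continuous_arcsin.comp_continuousOn (ContinuousOn.div (by fun_prop) (by fun_prop)
        fun x hx => mul_ne_zero (hpos x hx) hD)
    exact (h1.continuousOn.add (continuousOn_const.mul h2.continuousOn)).sub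
      (continuousOn_const.mul h3)

theorem integral_rhoMP {d : ℝ} (hd0 : 0 < d) (hd1 : d < 1) :
    ∫ x in (aMP d)..(bMP d), rhoMP d x = 1 := by
  have hsd : Real.sqrt d < 1 := sqrt_lt_one hd1
  have hs0 := Real.sqrt_pos.2 hd0
  have hkey := integral_sqrt_div (s := 1 - Real.sqrt d) (t := 1 + Real.sqrt d)
    (by linarith) (by linarith)
  have hcongr : ∫ x in (aMP d)..(bMP d), rhoMP d x = ∫ x in (aMP d)..(bMP d),
      (1 / (2 * Real.pi * d)) * (Real.sqrt ((bMP d - x) * (x - aMP d)) / x) := by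
    refine intervalIntegral.integral_congr fun x hx => ?_
    rw [Set.uIcc_of_le (aMP_lt_bMP hd0).le] at hx
    have := (aMP_pos hd1).trans_le hx.1
    simp only [rhoMP_eq hx]
    field_simp
  rw [hcongr, intervalIntegral.integral_const_mul, aMP, bMP, hkey]
  have hsq : Real.sqrt d ^ 2 = d := Real.sq_sqrt hd0.le
  have : (1 + Real.sqrt d - (1 - Real.sqrt d)) ^ 2 = 4 * d := by nlinarith
  rw [this]
  field_simp
  norm_num

/-- Near the left edge the density dominates a multiple of a square root. -/
theorem le_rhoMP {d lo y x : ℝ} (hlo : 0 < lo) (hd : lo ≤ d) (hd1 : d < 1) (hy : 0 ≤ y)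
    (hyx : aMP d + y ≤ x) (hx : x ≤ aMP d + 2 * lo) :
    1 / (8 * Real.pi) * Real.sqrt (2 * lo * y) ≤ rhoMP d x := by
  have hd0 := hlo.trans_le hd
  have hsd : d ≤ Real.sqrt d := Real.le_sqrt_of_sq_le (by nlinarith)
  have hba := bMP_sub_aMP d
  have hxI : x ∈ Set.Icc (aMP d) (bMP d) := ⟨by linarith, by linarith⟩
  have hx0 := (aMP_pos hd1).trans_le hxI.1
  have hx4 : x ≤ 4 := hxI.2.trans (bMP_le_four hd1)
  rw [rhoMP_eq hxI]
  have hdx : d * x ≤ 1 * 4 := by gcongr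
  have hle : 2 * Real.pi * d * x ≤ 8 * Real.pi := by nlinarith [Real.pi_pos]
  have hrad : 2 * lo * y ≤ (bMP d - x) * (x - aMP d) := by
    exact mul_le_mul (by linarith) (by linarith) hy (by linarith)
  gcongr

/-- The solution of the critical equation stays away from the left edge, uniformly for ratios
bounded away from `0` and `1`. -/
theorem exists_edge_gap {lo hi N : ℝ} (hlo : 0 < lo) (hhi : hi < 1) (hN : 0 < N) :
    ∃ δ > 0, ∀ d ∈ Set.Icc lo hi, ∀ c ∈ Set.Ioo 0 (aMP d),
      ∫ x in (aMP d)..(bMP d), (c / (x - c)) ^ 2 * rhoMP d x ≤ N → δ ≤ aMP d - c := by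
  have hα := aMP_pos hhi
  set α := aMP hi with hαdef
  set κ := 1 / (8 * Real.pi) * Real.sqrt (2 * lo) with hκ
  have hκ0 : 0 < κ := by positivity
  set δ₁ := (κ * α ^ 2 / (36 * N)) ^ 2 with hδ₁
  refine ⟨min (min (α / 2) lo) δ₁, by positivity, fun d hd c hc hint => ?_⟩
  by_contra! hlt
  have hd0 : 0 < d := hlo.trans_le hd.1
  have hd1 : d < 1 := hd.2.trans_lt hhi
  have hαd : α ≤ aMP d := by
    have h1 : Real.sqrt d ≤ Real.sqrt hi := Real.sqrt_le_sqrt hd.2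
    have h2 : Real.sqrt hi < 1 := sqrt_lt_one hhi
    unfold aMP at hαdef ⊢
    rw [hαdef]
    gcongr
  set δ := aMP d - c with hδ
  have hδ0 : 0 < δ := sub_pos.2 hc.2
  simp only [lt_min_iff] at hlt
  obtain ⟨⟨h1, h2⟩, h3⟩ := hlt
  have hcα : α / 2 ≤ c := by linarith
  have hsd : d ≤ Real.sqrt d := Real.le_sqrt_of_sq_le (by nlinarith)
  have hba := bMP_sub_aMP d
  have hlo' := hd.1
  have hρc := continuousOn_rhoMP hd0 hd1
  have hcont : ContinuousOn (fun x => (c / (x - c)) ^ 2 * rhoMP d x)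
      (Set.Icc (aMP d) (bMP d)) := by
    refine ((ContinuousOn.div continuousOn_const (by fun_prop) fun x hx => ?_).pow 2).mul hρc
    have := hx.1
    exact (by linarith : 0 < x - c).ne'
  have hsub : ∫ x in (aMP d + δ)..(aMP d + 2 * δ), (c / (x - c)) ^ 2 * rhoMP d x ≤
      ∫ x in (aMP d)..(bMP d), (c / (x - c)) ^ 2 * rhoMP d x := by
    apply intervalIntegral.integral_mono_interval (by linarith) (by linarith) (by linarith)
    · refine (ae_restrict_iff' measurableSet_Ioc).2 (Eventually.of_forall fun x hx => ?_)
      exact mul_nonneg (sq_nonneg _) (rhoMP_nonneg hd0 hd1 ⟨hx.1.le, hx.2⟩)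
    · apply ContinuousOn.intervalIntegrable
      rwa [Set.uIcc_of_le (aMP_lt_bMP hd0).le]
  have hlow : ∫ x in (aMP d + δ)..(aMP d + 2 * δ), (α / 2 / (3 * δ)) ^ 2 * (κ * Real.sqrt δ) ≤
      ∫ x in (aMP d + δ)..(aMP d + 2 * δ), (c / (x - c)) ^ 2 * rhoMP d x := by
    refine intervalIntegral.integral_mono_on (by linarith) (by simp) ?_ fun x hx => ?_
    · apply ContinuousOn.intervalIntegrable
      rw [Set.uIcc_of_le (by linarith)]
      exact hcont.mono (Set.Icc_subset_Icc (by linarith) (by linarith))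
    · have hx1 := hx.1
      have hx2 := hx.2
      have hxc : 0 < x - c := by linarith
      have hρ := le_rhoMP hlo hd.1 hd1 hδ0.le hx.1 (by linarith : x ≤ aMP d + 2 * lo)
      rw [Real.sqrt_mul (by positivity), ← mul_assoc, ← hκ] at hρ
      have hc0 := hc.1
      gcongr
      linarith
  rw [intervalIntegral.integral_const, smul_eq_mul] at hlow
  have hle := hlow.trans (hsub.trans hint)
  set r := Real.sqrt δ with hr
  have hr0 : 0 < r := Real.sqrt_pos.2 hδ0
  have hr2 : δ = r ^ 2 := (Real.sq_sqrt hδ0.le).symm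
  have heq : (aMP d + 2 * δ - (aMP d + δ)) * ((α / 2 / (3 * δ)) ^ 2 * (κ * r)) =
      κ * α ^ 2 / (36 * r) := by
    rw [hr2]
    field_simp
    ring
  rw [heq, div_le_iff₀ (by positivity)] at hle
  have hle' : κ * α ^ 2 / (36 * N) ≤ r := by
    rw [div_le_iff₀ (by positivity)]; linarith
  have : δ₁ ≤ δ := by
    rw [hδ₁, hr2]
    gcongr
  linarith

theorem abs_functional_rhoMP_sub_le {d c c₀ δ R : ℝ} (hd0 : 0 < d) (hd1 : d < 1)
    (hδ : 0 < δ) (hcc : c₀ ∈ Set.Ioc 0 c) (hac : δ ≤ aMP d - c) {p n : ℕ} (hp : 0 < p)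
    (hn : 0 < n) (hR : (p : ℝ) / n ≤ R) {γ : ℕ → ℝ} (hγ0 : γ 0 = bMP d) (hγp : γ p = aMP d)
    (hγ : ∀ j, 1 ≤ j → j ≤ p - 1 → γ j ∈ Set.Ioo (aMP d) (bMP d) ∧
      (∫ x in (γ j)..(bMP d), rhoMP d x) = (j : ℝ) / p)
    (hc : ∫ x in (aMP d)..(bMP d), (c / (x - c)) ^ 2 * rhoMP d x = (n : ℝ) / p)
    (hc₀ : (1 / (p : ℝ)) * ∑ j ∈ Finset.Icc 1 p, (c₀ / (γ j - c₀)) ^ 2 = (n : ℝ) / p) (k : ℕ) :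
    |(1 / c ^ k) * (1 + (p : ℝ) / n * ∫ x in (aMP d)..(bMP d), (c / (x - c)) ^ k * rhoMP d x) -
      (1 / c₀ ^ k) * (1 + 1 / (n : ℝ) * ∑ j ∈ Finset.Icc 1 p, (c₀ / (γ j - c₀)) ^ k)|
    ≤ ((1 / δ) ^ 2 * R * k * ((1 / δ) ^ 2 * R) ^ (k - 1) +
        R * ((1 / δ) ^ 2 * R * (1 / δ) ^ 2 * k * (1 / δ) ^ (k - 1) + (1 / δ) ^ k)) / p := by
  have hp' : (0 : ℝ) < p := by exact_mod_cast hp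
  have hn' : (0 : ℝ) < n := by exact_mod_cast hn
  have hab := (aMP_lt_bMP hd0).le
  have hγint : ∀ j ≤ p, γ j ∈ Set.Icc (aMP d) (bMP d) ∧
      ∫ x in (γ j)..(bMP d), rhoMP d x = (j : ℝ) / p := by
    intro j hj
    rcases Nat.eq_zero_or_pos j with rfl | hj0
    · rw [hγ0]
      exact ⟨Set.right_mem_Icc.2 hab, by simp⟩
    · rcases hj.eq_or_lt with rfl | hjp
      · rw [hγp, integral_rhoMP hd0 hd1, div_self hp'.ne']
        exact ⟨Set.left_mem_Icc.2 hab, rfl⟩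
      · have h := hγ j hj0 (by omega)
        exact ⟨Set.Ioo_subset_Icc_self h.1, h.2⟩
  have h := abs_functional_sub_le (R := R) hab (aMP_le_one hd1) (continuousOn_rhoMP hd0 hd1)
    (fun x hx => rhoMP_nonneg hd0 hd1 hx) (integral_rhoMP hd0 hd1) hδ hcc.1 hcc.2 hac hp hγ0 hγp
    (fun j hj => (hγint j hj).1) (fun j hj => (hγint j hj).2) (div_pos hn' hp')
    (by rwa [one_div_div]) hc hc₀ k
  rwa [one_div_div, ← mul_assoc ((p : ℝ) / n), div_mul_div_cancel₀' hp'.ne'] at h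

/-- The inverse cube of the scaling factor is at least `1`. -/
theorem one_le_scaling {d c r : ℝ} (hd0 : 0 < d) (hd1 : d < 1) (hr : 0 ≤ r)
    (hc : c ∈ Set.Ioo 0 (aMP d)) :
    1 ≤ (1 / c ^ 3) * (1 + r * ∫ x in (aMP d)..(bMP d), (c / (x - c)) ^ 3 * rhoMP d x) := by
  have hI : 0 ≤ ∫ x in (aMP d)..(bMP d), (c / (x - c)) ^ 3 * rhoMP d x := by
    refine intervalIntegral.integral_nonneg (aMP_lt_bMP hd0).le fun x hx => ?_
    have h1 : 0 < x - c := by linarith [hx.1, hc.2]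
    have h2 := rhoMP_nonneg hd0 hd1 hx
    have h3 := hc.1
    positivity
  have hc1 : c ≤ 1 := hc.2.le.trans (aMP_le_one hd1)
  have h1 : 1 ≤ 1 / c ^ 3 := by
    rw [le_div_iff₀ (pow_pos hc.1 3), one_mul]
    exact pow_le_one₀ hc.1.le hc1
  exact one_le_mul_of_one_le_of_one_le h1 (by linarith [mul_nonneg hr hI])

/-! ### Passing to the limit -/

theorem tendsto_rpow_mul_of_le_div {n : ℕ → ℕ} {f : ℕ → ℝ} {M K : ℝ} (hK : 0 ≤ K)
    (hn : ∀ᶠ p : ℕ in atTop, (n p : ℝ) ≤ K * p) (hf0 : ∀ p, 0 ≤ f p)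
    (hf : ∀ᶠ p : ℕ in atTop, f p ≤ M / p) :
    Tendsto (fun p : ℕ => (n p : ℝ) ^ ((2 : ℝ) / 3) * f p) atTop (nhds 0) := by
  have hlim : Tendsto (fun p : ℕ => K ^ ((2 : ℝ) / 3) * M * (p : ℝ) ^ (-((1 : ℝ) / 3)))
      atTop (nhds 0) := by
    simpa using ((tendsto_rpow_neg_atTop (by norm_num : (0 : ℝ) < 1 / 3)).comp
      tendsto_natCast_atTop_atTop).const_mul (K ^ ((2 : ℝ) / 3) * M)
  refine squeeze_zero' (Eventually.of_forall fun p => mul_nonneg (by positivity) (hf0 p)) ?_ hlim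
  filter_upwards [hn, hf, eventually_gt_atTop 0] with p h1 h2 hp
  have hp' : (0 : ℝ) < p := by exact_mod_cast hp
  calc (n p : ℝ) ^ ((2 : ℝ) / 3) * f p ≤ (K * p) ^ ((2 : ℝ) / 3) * (M / p) := by
        gcongr
        exact hf0 p
    _ = K ^ ((2 : ℝ) / 3) * M * ((p : ℝ) ^ ((2 : ℝ) / 3) * (p : ℝ) ^ (-1 : ℝ)) := by
        rw [Real.mul_rpow hK hp'.le, Real.rpow_neg_one]
        ring
    _ = K ^ ((2 : ℝ) / 3) * M * (p : ℝ) ^ (-((1 : ℝ) / 3)) := by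
        rw [← Real.rpow_add hp']
        norm_num

theorem tendsto_div_of_abs_inv_cube_sub_le {σ σ₀ : ℕ → ℝ} {M : ℝ}
    (hσ : ∀ᶠ p in atTop, 0 < σ p) (hσ₀ : ∀ᶠ p in atTop, 0 < σ₀ p)
    (h1 : ∀ᶠ p in atTop, 1 ≤ 1 / σ p ^ 3)
    (h : ∀ᶠ p : ℕ in atTop, |1 / σ p ^ 3 - 1 / σ₀ p ^ 3| ≤ M / p) :
    Tendsto (fun p => σ p / σ₀ p) atTop (nhds 1) := by
  have hcube : Tendsto (fun p => (σ p / σ₀ p) ^ 3) atTop (nhds 1) := by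
    rw [tendsto_iff_dist_tendsto_zero]
    refine squeeze_zero' (Eventually.of_forall fun p => dist_nonneg) ?_
      (tendsto_const_div_atTop_nhds_zero_nat M)
    filter_upwards [hσ, hσ₀, h1, h] with p h2 h3 h4 h5
    refine le_trans ?_ h5
    have h6 : σ p ^ 3 ≤ 1 := by rwa [le_div_iff₀ (by positivity), one_mul] at h4
    have h7 : (σ p / σ₀ p) ^ 3 - 1 = σ p ^ 3 * (1 / σ₀ p ^ 3 - 1 / σ p ^ 3) := by field_simp
    rw [Real.dist_eq, h7, abs_mul, abs_of_pos (by positivity), abs_sub_comm]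
    exact mul_le_of_le_one_left (abs_nonneg _) h6
  have hroot := hcube.rpow_const (p := (1 : ℝ) / 3) (Or.inl one_ne_zero)
  rw [Real.one_rpow] at hroot
  refine hroot.congr' ?_
  filter_upwards [hσ, hσ₀] with p h2 h3
  rw [← Real.rpow_natCast, ← Real.rpow_mul (by positivity)]
  norm_num

end MarchenkoPastur

/-- under Condition 3 with `0 < d₁ < 1`, there is a constant `M` such that for
all large `p`, `|μ_p − μ_{p,0}| ≤ M/p` and `|1/σ_p³ − 1/σ_{p,0}³| ≤ M/p`; consequently
`n^{2/3}·|μ_p − μ_{p,0}| → 0` and `σ_p/σ_{p,0} → 1`. -/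
theorem stmt_9 (m n : ℕ → ℕ) (d₁ d₂ d₃ : ℝ)
    (hd₁ : d₁ ∈ Set.Ioo (0 : ℝ) 1) (hd₂ : 0 < d₂) (hd₃ : d₃ ∈ Set.Ioo (0 : ℝ) 1)
    (hm : Tendsto (fun p : ℕ => (p : ℝ) / m p) atTop (nhds d₁))
    (hn : Tendsto (fun p : ℕ => (p : ℝ) / n p) atTop (nhds d₂))
    (hmn : Tendsto (fun p : ℕ => (p : ℝ) / ((m p : ℝ) + n p)) atTop (nhds d₃))
    (c : ℕ → ℝ)
    (hc : ∀ᶠ p : ℕ in atTop,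
      c p ∈ Set.Ioo 0 (aMP ((p : ℝ) / m p)) ∧
      (∫ x in (aMP ((p : ℝ) / m p))..(bMP ((p : ℝ) / m p)),
          (c p / (x - c p)) ^ 2 * rhoMP ((p : ℝ) / m p) x) = (n p : ℝ) / p)
    (μ : ℕ → ℝ)
    (hμ : ∀ p, μ p = (1 / c p) * (1 + ((p : ℝ) / n p) *
        ∫ x in (aMP ((p : ℝ) / m p))..(bMP ((p : ℝ) / m p)),
          (c p / (x - c p)) * rhoMP ((p : ℝ) / m p) x))
    (σ : ℕ → ℝ)
    (hσ : ∀ᶠ p : ℕ in atTop, 0 < σ p ∧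
      1 / σ p ^ 3 = (1 / c p ^ 3) * (1 + ((p : ℝ) / n p) *
        ∫ x in (aMP ((p : ℝ) / m p))..(bMP ((p : ℝ) / m p)),
          (c p / (x - c p)) ^ 3 * rhoMP ((p : ℝ) / m p) x))
    (γq : ℕ → ℕ → ℝ)
    (hγq : ∀ᶠ p : ℕ in atTop,
      γq p 0 = bMP ((p : ℝ) / m p) ∧ γq p p = aMP ((p : ℝ) / m p) ∧
      ∀ j, 1 ≤ j → j ≤ p - 1 →
        γq p j ∈ Set.Ioo (aMP ((p : ℝ) / m p)) (bMP ((p : ℝ) / m p)) ∧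
        (∫ x in (γq p j)..(bMP ((p : ℝ) / m p)), rhoMP ((p : ℝ) / m p) x) = (j : ℝ) / p)
    (c₀ : ℕ → ℝ)
    (hc₀ : ∀ᶠ p : ℕ in atTop,
      c₀ p ∈ Set.Ioc 0 (c p) ∧
      (1 / (p : ℝ)) * ∑ j ∈ Finset.Icc 1 p, (c₀ p / (γq p j - c₀ p)) ^ 2 = (n p : ℝ) / p)
    (μ₀ : ℕ → ℝ)
    (hμ₀ : ∀ p, μ₀ p = (1 / c₀ p) *
        (1 + (1 / (n p : ℝ)) * ∑ j ∈ Finset.Icc 1 p, c₀ p / (γq p j - c₀ p)))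
    (σ₀ : ℕ → ℝ)
    (hσ₀ : ∀ᶠ p : ℕ in atTop, 0 < σ₀ p ∧
      1 / σ₀ p ^ 3 = (1 / c₀ p ^ 3) *
        (1 + (1 / (n p : ℝ)) * ∑ j ∈ Finset.Icc 1 p, (c₀ p / (γq p j - c₀ p)) ^ 3)) :
    (∃ M : ℝ, ∀ᶠ p : ℕ in atTop,
        |μ p - μ₀ p| ≤ M / p ∧ |1 / σ p ^ 3 - 1 / σ₀ p ^ 3| ≤ M / p) ∧
      Tendsto (fun p : ℕ => (n p : ℝ) ^ ((2 : ℝ) / 3) * |μ p - μ₀ p|) atTop (nhds 0) ∧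
      Tendsto (fun p : ℕ => σ p / σ₀ p) atTop (nhds 1) := by
  set lo := d₁ / 2 with hlo_def
  set hi := (1 + d₁) / 2 with hhi_def
  have hlo : 0 < lo := half_pos hd₁.1
  have hhi : hi < 1 := by linarith [hd₁.2]
  have hN : 0 < 2 / d₂ := by positivity
  obtain ⟨δ, hδ, hgap⟩ := MarchenkoPastur.exists_edge_gap hlo hhi hN
  have hd : ∀ᶠ p : ℕ in atTop, (p : ℝ) / m p ∈ Set.Icc lo hi :=
    hm.eventually (Icc_mem_nhds (half_lt_self hd₁.1) (by linarith [hd₁.2]))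
  have hnlo : ∀ᶠ p : ℕ in atTop, d₂ / 2 < (p : ℝ) / n p := hn.eventually_const_lt (half_lt_self hd₂)
  have hnhi : ∀ᶠ p : ℕ in atTop, (p : ℝ) / n p ≤ 2 * d₂ := hn.eventually_le_const (by linarith)
  have hn0 : ∀ᶠ p : ℕ in atTop, 0 < n p := by
    filter_upwards [hnlo] with p hp
    by_contra! h0
    rw [Nat.le_zero.1 h0, Nat.cast_zero, div_zero] at hp
    linarith
  have hnp : ∀ᶠ p : ℕ in atTop, (n p : ℝ) ≤ 2 / d₂ * p := by
    filter_upwards [hnlo, hn0] with p h1 h2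
    have h2' : (0 : ℝ) < n p := by exact_mod_cast h2
    rw [lt_div_iff₀ h2'] at h1
    rw [div_mul_eq_mul_div, le_div_iff₀ hd₂]
    linarith
  set B : ℕ → ℝ := fun k => (1 / δ) ^ 2 * (2 * d₂) * k * ((1 / δ) ^ 2 * (2 * d₂)) ^ (k - 1) +
    (2 * d₂) * ((1 / δ) ^ 2 * (2 * d₂) * (1 / δ) ^ 2 * k * (1 / δ) ^ (k - 1) + (1 / δ) ^ k)
  have hmain : ∀ᶠ p : ℕ in atTop, ∀ k : ℕ,
      |(1 / c p ^ k) * (1 + (p : ℝ) / n p * ∫ x in (aMP ((p : ℝ) / m p))..(bMP ((p : ℝ) / m p)),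
          (c p / (x - c p)) ^ k * rhoMP ((p : ℝ) / m p) x) -
        (1 / c₀ p ^ k) *
          (1 + 1 / (n p : ℝ) * ∑ j ∈ Finset.Icc 1 p, (c₀ p / (γq p j - c₀ p)) ^ k)| ≤ B k / p := by
    filter_upwards [hd, hnhi, hn0, hnp, hc, hγq, hc₀, eventually_gt_atTop 0]
      with p h1 h2 h3 h4 h5 h6 h7 h8 k
    refine MarchenkoPastur.abs_functional_rhoMP_sub_le (hlo.trans_le h1.1) (h1.2.trans_lt hhi) hδ
      h7.1 (hgap _ h1 _ h5.1 ?_) h8 h3 h2 h6.1 h6.2.1 h6.2.2 h5.2 h7.2 k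
    have h8' : (0 : ℝ) < p := by exact_mod_cast h8
    rwa [h5.2, div_le_iff₀ h8']
  have hμB : ∀ᶠ p : ℕ in atTop, |μ p - μ₀ p| ≤ B 1 / p := by
    filter_upwards [hmain] with p h
    simpa only [hμ, hμ₀, pow_one] using h 1
  have hσB : ∀ᶠ p : ℕ in atTop, |1 / σ p ^ 3 - 1 / σ₀ p ^ 3| ≤ B 3 / p := by
    filter_upwards [hmain, hσ, hσ₀] with p h h1 h2
    rw [h1.2, h2.2]
    exact h 3
  refine ⟨⟨max (B 1) (B 3), ?_⟩, ?_, ?_⟩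
  · filter_upwards [hμB, hσB] with p h1 h3
    exact ⟨h1.trans (by gcongr; exact le_max_left _ _), h3.trans (by gcongr; exact le_max_right _ _)⟩
  · exact MarchenkoPastur.tendsto_rpow_mul_of_le_div hN.le hnp (fun p => abs_nonneg _) hμB
  · refine MarchenkoPastur.tendsto_div_of_abs_inv_cube_sub_le (hσ.mono fun p h => h.1)
      (hσ₀.mono fun p h => h.1) ?_ hσB
    filter_upwards [hσ, hc, hd] with p h1 h2 h3
    rw [h1.2]
    exact MarchenkoPastur.one_le_scaling (hlo.trans_le h3.1) (h3.2.trans_lt hhi) (by positivity) h2.1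
end

section
/- Under Condition 3 with 0 < d₁ < 1, there exists ζ₀ > 0 such that for every ζ ∈ (0, ζ₀) the following holds for all sufficiently large p: if γ̂_1 ≥ … ≥ γ̂_p > 0 satisfy |γ̂_j − γ_j| ≤ p^{ζ − 2/3}·(min(j, p+1−j))^{−1/3} for all j, and ĉ_p ∈ (0, γ̂_p) solves (1/p)·Σ_{j=1}^p ( ĉ_p/(γ̂_j − ĉ_p) )² = n/p, then with μ̂_p = (1/ĉ_p)·(1 + (1/n)·Σ_{j=1}^p ĉ_p/(γ̂_j − ĉ_p)) and 1/σ̂_p³ = (1/ĉ_p³)·(1 + (1/n)·Σ_{j=1}^p ( ĉ_p/(γ̂_j − ĉ_p) )³), one has |μ̂_p − μ_{p,0}| ≤ M·p^{ζ−1} and |1/σ̂_p³ − 1/σ_{p,0}³| ≤ M·p^{ζ−1} for a constant M independent of p; consequently n^{2/3}·|μ̂_p − μ_{p,0}| → 0 and σ̂_p/σ_{p,0} → 1. -/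
open MeasureTheory Filter

theorem hasDerivAt_sqrt_div_antideriv {a b x : ℝ} (ha : 0 < a) (hax : a < x) (hxb : x < b) :
    HasDerivAt (fun x => Real.sqrt ((b - x) * (x - a))
      + (a + b) / 2 * Real.arcsin ((2 * x - (a + b)) / (b - a))
      - Real.sqrt (a * b) * Real.arcsin (((a + b) - 2 * (a * b) / x) / (b - a)))
      (Real.sqrt ((b - x) * (x - a)) / x) x := by
  have hx : 0 < x := ha.trans hax
  have hb : 0 < b := hx.trans hxb
  have hba : 0 < b - a := by linarith
  have hR : 0 < (b - x) * (x - a) := mul_pos (by linarith) (by linarith)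
  have hab : 0 < a * b := mul_pos ha hb
  set s := Real.sqrt ((b - x) * (x - a)) with hs
  set t := Real.sqrt (a * b) with ht
  have hs0 : 0 < s := Real.sqrt_pos.2 hR
  have ht0 : 0 < t := Real.sqrt_pos.2 hab
  have hs2 : s ^ 2 = (b - x) * (x - a) := Real.sq_sqrt hR.le
  have ht2 : t ^ 2 = a * b := Real.sq_sqrt hab.le
  have h1 : 1 - ((2 * x - (a + b)) / (b - a)) ^ 2 = (2 * s / (b - a)) ^ 2 := by
    rw [div_pow, div_pow, mul_pow, hs2]; field_simp; ring
  have h2 : 1 - (((a + b) - 2 * (a * b) / x) / (b - a)) ^ 2 = (2 * t * s / (x * (b - a))) ^ 2 := by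
    rw [div_pow, div_pow, mul_pow, mul_pow, hs2, ht2]; field_simp; ring
  have h1p : 0 < 2 * s / (b - a) := by positivity
  have h2p : 0 < 2 * t * s / (x * (b - a)) := by positivity
  have ne : ∀ {y z : ℝ}, 0 < z → 1 - y ^ 2 = z ^ 2 → y ≠ -1 ∧ y ≠ 1 := by
    intro y z hz h
    have := pow_pos hz 2
    constructor <;> rintro rfl <;> norm_num at h <;> linarith
  have d1 : HasDerivAt (fun x => Real.sqrt ((b - x) * (x - a)))
      ((-1 * (x - a) + (b - x) * 1) / (2 * s)) x :=
    (((hasDerivAt_id x).const_sub b).mul ((hasDerivAt_id x).sub_const a)).sqrt hR.ne'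
  have d2 := (Real.hasDerivAt_arcsin (ne h1p h1).1 (ne h1p h1).2).comp x
    ((((hasDerivAt_id x).const_mul 2).sub_const (a + b)).div_const (b - a))
  have d3 := (Real.hasDerivAt_arcsin (ne h2p h2).1 (ne h2p h2).2).comp x
    ((((hasDerivAt_inv hx.ne').const_mul (2 * (a * b))).const_sub (a + b)).div_const (b - a))
  simp only [id, mul_one] at d2
  simp only [← div_eq_mul_inv] at d3
  rw [h1, Real.sqrt_sq h1p.le] at d2
  rw [h2, Real.sqrt_sq h2p.le] at d3
  refine ((d1.add (d2.const_mul ((a + b) / 2))).sub (d3.const_mul t)).congr_deriv ?_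
  field_simp
  rw [hs2]
  ring

theorem continuousOn_sqrt_div {a b : ℝ} (ha : 0 < a) :
    ContinuousOn (fun x => Real.sqrt ((b - x) * (x - a)) / x) (Set.Icc a b) :=
  ContinuousOn.div (by fun_prop) continuousOn_id fun x hx => (ha.trans_le hx.1).ne'

theorem integral_sqrt_div {a b : ℝ} (ha : 0 < a) (hab : a < b) :
    ∫ x in a..b, Real.sqrt ((b - x) * (x - a)) / x
      = Real.pi * ((a + b) / 2 - Real.sqrt (a * b)) := by
  have hb : 0 < b := ha.trans hab
  have hba : 0 < b - a := by linarith
  rw [intervalIntegral.integral_eq_sub_of_hasDerivAt_of_le hab.le (f := fun x =>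
      Real.sqrt ((b - x) * (x - a))
      + (a + b) / 2 * Real.arcsin ((2 * x - (a + b)) / (b - a))
      - Real.sqrt (a * b) * Real.arcsin (((a + b) - 2 * (a * b) / x) / (b - a)))]
  · have e1 : (2 * b - (a + b)) / (b - a) = 1 := by field_simp; ring
    have e2 : (2 * a - (a + b)) / (b - a) = -1 := by field_simp; ring
    have e3 : (a + b - 2 * (a * b) / b) / (b - a) = 1 := by field_simp; ring
    have e4 : (a + b - 2 * (a * b) / a) / (b - a) = -1 := by field_simp; ring
    simp only [e1, e2, e3, e4, Real.arcsin_one, Real.arcsin_neg_one, sub_self, zero_mul, mul_zero,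
      Real.sqrt_zero]
    ring
  · have h : ContinuousOn (fun x : ℝ => 2 * (a * b) / x) (Set.Icc a b) :=
      continuousOn_const.div continuousOn_id fun x hx => (ha.trans_le hx.1).ne'
    refine ContinuousOn.sub (by fun_prop) (continuousOn_const.mul ?_)
    exact Real.continuous_arcsin.comp_continuousOn ((continuousOn_const.sub h).div_const _)
  · exact fun x hx => hasDerivAt_sqrt_div_antideriv ha hx.1 hx.2
  · refine ContinuousOn.intervalIntegrable ?_
    rw [Set.uIcc_of_le hab.le]
    exact continuousOn_sqrt_div ha

theorem bMP_sub_aMP (d : ℝ) : bMP d - aMP d = 4 * Real.sqrt d := by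
  unfold bMP aMP; ring

theorem integral_rhoMP_eq {d y : ℝ} (hy : aMP d ≤ y) (hyb : y ≤ bMP d) :
    ∫ x in y..(bMP d), rhoMP d x = 1 / (2 * Real.pi * d) *
      ∫ x in y..(bMP d), Real.sqrt ((bMP d - x) * (x - aMP d)) / x := by
  rw [← intervalIntegral.integral_const_mul]
  refine intervalIntegral.integral_congr fun x hx => ?_
  rw [Set.uIcc_of_le hyb] at hx
  simp only [rhoMP, if_pos (And.intro (hy.trans hx.1) hx.2)]
  ring

/-- Near the left edge the Marchenko–Pastur law has mass of order `δ ^ (3 / 2)`. -/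
theorem integral_rhoMP_le {d y δ : ℝ} (h0 : 0 < d) (h1 : d < 1) (hδ : 0 < δ)
    (hδd : δ ≤ Real.sqrt d) (hy : aMP d + δ ≤ y) (hyb : y ≤ bMP d) :
    ∫ x in y..(bMP d), rhoMP d x ≤ 1 - Real.sqrt (Real.sqrt d * δ) * δ / (16 * Real.pi) := by
  have ha := aMP_pos h1
  have hs : 0 < Real.sqrt d := Real.sqrt_pos.2 h0
  have hs1 : Real.sqrt d < 1 := by rw [Real.sqrt_lt' one_pos]; simpa
  have hba := bMP_sub_aMP d
  have hb4 := bMP_le_four h1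
  have hab : aMP d < bMP d := by linarith
  rw [integral_rhoMP_eq (by linarith) hyb]
  set f := fun x => Real.sqrt ((bMP d - x) * (x - aMP d)) / x with hf
  have hintegral : ∀ u v, aMP d ≤ u → u ≤ v → v ≤ bMP d → IntervalIntegrable f volume u v := by
    intro u v hu huv hv
    refine ContinuousOn.intervalIntegrable ?_
    rw [Set.uIcc_of_le huv]
    exact (continuousOn_sqrt_div ha).mono (Set.Icc_subset_Icc hu hv)
  have htot : ∫ x in (aMP d)..(bMP d), f x = 2 * Real.pi * d := by
    rw [integral_sqrt_div ha hab]
    have e : aMP d * bMP d = (1 - d) ^ 2 := by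
      unfold aMP bMP
      rw [← mul_pow]
      congr 1
      nlinarith [Real.sq_sqrt h0.le]
    have e' : (aMP d + bMP d) / 2 = 1 + d := by
      unfold aMP bMP
      nlinarith [Real.sq_sqrt h0.le]
    rw [e, e', Real.sqrt_sq (by linarith)]
    ring
  have hadd := intervalIntegral.integral_add_adjacent_intervals
    (hintegral (aMP d) y le_rfl (by linarith) hyb) (hintegral y (bMP d) (by linarith) hyb le_rfl)
  have hmono : ∫ x in (aMP d + δ / 2)..(aMP d + δ), f x ≤ ∫ x in (aMP d)..y, f x := by
    refine intervalIntegral.integral_mono_interval (by linarith) (by linarith) hy ?_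
      (hintegral _ _ le_rfl (by linarith) hyb)
    filter_upwards [ae_restrict_mem measurableSet_Ioc] with x hx
    exact div_nonneg (Real.sqrt_nonneg _) (ha.trans hx.1).le
  have hlow : ∫ _x in (aMP d + δ / 2)..(aMP d + δ), Real.sqrt (Real.sqrt d * δ) / 4
      ≤ ∫ x in (aMP d + δ / 2)..(aMP d + δ), f x := by
    refine intervalIntegral.integral_mono_on (by linarith) intervalIntegrable_const
      (hintegral _ _ (by linarith) (by linarith) (by linarith)) fun x hx => ?_
    have hx0 : 0 < x := by linarith [hx.1]
    refine div_le_div₀ (Real.sqrt_nonneg _) (Real.sqrt_le_sqrt ?_) hx0 (by linarith [hx.2])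
    have : (2 * Real.sqrt d) * (δ / 2) ≤ (bMP d - x) * (x - aMP d) :=
      mul_le_mul (by linarith [hx.2]) (by linarith [hx.1]) (by linarith) (by linarith [hx.2])
    linarith
  rw [intervalIntegral.integral_const, smul_eq_mul] at hlow
  have hpd : 0 < 2 * Real.pi * d := by positivity
  set q := Real.sqrt (Real.sqrt d * δ)
  have hq : 0 ≤ q := Real.sqrt_nonneg _
  have hle : ∫ x in y..(bMP d), f x ≤ 2 * Real.pi * d - δ * q / 8 := by linarith
  rw [one_div, inv_mul_le_iff₀ hpd]
  refine hle.trans ?_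
  have : 2 * Real.pi * d * (1 - q * δ / (16 * Real.pi)) = 2 * Real.pi * d - d * (δ * q / 8) := by
    field_simp
    ring
  rw [this]
  have : 0 ≤ δ * q / 8 := by positivity
  nlinarith

theorem sum_Icc_rpow_neg_third_le (p : ℕ) :
    ∑ j ∈ Finset.Icc 1 p, (j : ℝ) ^ (-(1 : ℝ) / 3) ≤ 3 / 2 * (p : ℝ) ^ ((2 : ℝ) / 3) := by
  induction p with
  | zero => simp
  | succ k ih =>
    rw [Finset.sum_Icc_succ_top (by omega)]
    have hk : (0 : ℝ) ≤ k := Nat.cast_nonneg k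
    have hk1 : (0 : ℝ) < (k : ℝ) + 1 := by positivity
    have amgm := Real.geom_mean_le_arith_mean2_weighted (w₁ := 2 / 3) (w₂ := 1 / 3)
      (p₁ := (k : ℝ)) (p₂ := (k : ℝ) + 1) (by norm_num) (by norm_num) hk hk1.le (by norm_num)
    push_cast
    have e1 : ((k : ℝ) + 1) ^ ((2 : ℝ) / 3) * ((k : ℝ) + 1) ^ ((1 : ℝ) / 3) = (k : ℝ) + 1 := by
      rw [← Real.rpow_add hk1]; norm_num
    have e2 : ((k : ℝ) + 1) ^ (-(1 : ℝ) / 3) * ((k : ℝ) + 1) ^ ((1 : ℝ) / 3) = 1 := by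
      rw [← Real.rpow_add hk1]; norm_num
    have hpos : 0 < ((k : ℝ) + 1) ^ ((1 : ℝ) / 3) := Real.rpow_pos_of_pos hk1 _
    refine le_of_mul_le_mul_right ?_ hpos
    nlinarith

theorem sum_Icc_min_rpow_neg_third_le (p : ℕ) :
    ∑ j ∈ Finset.Icc 1 p, ((min j (p + 1 - j) : ℕ) : ℝ) ^ (-(1 : ℝ) / 3)
      ≤ 3 * (p : ℝ) ^ ((2 : ℝ) / 3) := by
  have h := sum_Icc_rpow_neg_third_le p
  have hrefl : ∑ j ∈ Finset.Icc 1 p, ((p + 1 - j : ℕ) : ℝ) ^ (-(1 : ℝ) / 3)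
      = ∑ j ∈ Finset.Icc 1 p, (j : ℝ) ^ (-(1 : ℝ) / 3) := by
    refine Finset.sum_bij' (fun j _ => p + 1 - j) (fun j _ => p + 1 - j) ?_ ?_ ?_ ?_ ?_ <;>
      intro j hj <;> simp only [Finset.mem_Icc] at hj ⊢ <;> omega
  calc _ ≤ ∑ j ∈ Finset.Icc 1 p,
        ((j : ℝ) ^ (-(1 : ℝ) / 3) + ((p + 1 - j : ℕ) : ℝ) ^ (-(1 : ℝ) / 3)) := by
        refine Finset.sum_le_sum fun j _ => ?_
        have h1 : (0 : ℝ) ≤ (j : ℝ) ^ (-(1 : ℝ) / 3) := by positivity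
        have h2 : (0 : ℝ) ≤ ((p + 1 - j : ℕ) : ℝ) ^ (-(1 : ℝ) / 3) := by positivity
        rcases min_choice j (p + 1 - j) with h | h <;> rw [h] <;> linarith
    _ ≤ _ := by rw [Finset.sum_add_distrib, hrefl]; linarith

/-- If at least a fraction `κ` of the points lies within `D` of `c`, the mean of the squares
`(c / (g j - c)) ^ 2` is at least `κ * (c / D) ^ 2`. -/
theorem mul_sq_div_le_mean {p : ℕ} (hp : 1 ≤ p) {g : ℕ → ℝ} {c D κ : ℝ} (hc : 0 ≤ c)
    (hκ : κ ≤ 1) (hg : ∀ j ∈ Finset.Icc 1 p, (p : ℝ) - j < κ * p → 0 < g j - c ∧ g j - c ≤ D) :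
    κ * (c / D) ^ 2 ≤ (1 / (p : ℝ)) * ∑ j ∈ Finset.Icc 1 p, (c / (g j - c)) ^ 2 := by
  have hp0 : (0 : ℝ) < p := by exact_mod_cast hp
  set N := ⌈κ * p⌉₊ with hN
  have hNp : N ≤ p := Nat.ceil_le.2 (by nlinarith)
  have hsub : Finset.Ioc (p - N) p ⊆ Finset.Icc 1 p := fun j hj => by
    simp only [Finset.mem_Ioc, Finset.mem_Icc] at hj ⊢; omega
  have h1 : ∀ j ∈ Finset.Ioc (p - N) p, (c / D) ^ 2 ≤ (c / (g j - c)) ^ 2 := by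
    intro j hj
    have hj' := hj
    simp only [Finset.mem_Ioc] at hj'
    have hlt : p - j < N := by omega
    rw [hN, Nat.lt_ceil, Nat.cast_sub hj'.2] at hlt
    obtain ⟨h1, h2⟩ := hg j (hsub hj) hlt
    have hD : 0 ≤ c / D := div_nonneg hc (h1.le.trans h2)
    exact pow_le_pow_left₀ hD (div_le_div_of_nonneg_left hc h1 h2) 2
  have h2 := Finset.card_nsmul_le_sum _ _ _ h1
  have h3 := Finset.sum_le_sum_of_subset_of_nonneg hsub
    (f := fun j => (c / (g j - c)) ^ 2) fun _ _ _ => sq_nonneg _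
  rw [Nat.card_Ioc, Nat.sub_sub_self hNp, nsmul_eq_mul] at h2
  have h4 : κ * p * (c / D) ^ 2 ≤ N * (c / D) ^ 2 :=
    mul_le_mul_of_nonneg_right (Nat.le_ceil _) (sq_nonneg _)
  rw [one_div, ← div_eq_inv_mul, le_div_iff₀ hp0]
  linarith

/-- `γ` is the sequence of `p`-quantiles of the Marchenko–Pastur law, counted from the right. -/
def IsMPQuantile (p : ℕ) (d : ℝ) (γ : ℕ → ℝ) : Prop :=
  γ p = aMP d ∧ ∀ j, 1 ≤ j → j ≤ p - 1 → γ j ∈ Set.Ioo (aMP d) (bMP d) ∧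
    (∫ x in (γ j)..(bMP d), rhoMP d x) = (j : ℝ) / p

theorem IsMPQuantile.mem_Icc {p : ℕ} {d : ℝ} {γ : ℕ → ℝ} (h : IsMPQuantile p d γ) {j : ℕ}
    (hj : j ∈ Finset.Icc 1 p) : γ j ∈ Set.Icc (aMP d) (bMP d) := by
  rw [Finset.mem_Icc] at hj
  rcases hj.2.eq_or_lt with rfl | hlt
  · rw [h.1]
    exact ⟨le_rfl, by linarith [bMP_sub_aMP d, Real.sqrt_nonneg d]⟩
  · exact Set.Ioo_subset_Icc_self (h.2 j hj.1 (by omega)).1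

theorem IsMPQuantile.le_of_near {p : ℕ} {d e t : ℝ} {γ : ℕ → ℝ} (h : IsMPQuantile p d γ)
    (he : 0 < e) (hed : e ≤ d) (hd : d < 1) (ht : 0 < t) (ht1 : t ≤ 1) {j : ℕ}
    (hj : j ∈ Finset.Icc 1 p) (hnear : (p : ℝ) - j < e * t ^ 3 / (16 * Real.pi) * p) :
    γ j ≤ aMP d + Real.sqrt e * t ^ 2 := by
  rw [Finset.mem_Icc] at hj
  have hse : 0 < Real.sqrt e := Real.sqrt_pos.2 he
  have hsed : Real.sqrt e ≤ Real.sqrt d := Real.sqrt_le_sqrt hed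
  have hp0 : (0 : ℝ) < p := by exact_mod_cast hj.1.trans hj.2
  rcases hj.2.eq_or_lt with rfl | hlt
  · rw [h.1]
    have : 0 < Real.sqrt e * t ^ 2 := by positivity
    linarith
  by_contra! hcon
  obtain ⟨hmem, hintegral⟩ := h.2 j hj.1 (by omega)
  have hδd : Real.sqrt e * t ^ 2 ≤ Real.sqrt d := by nlinarith [pow_le_one₀ ht.le ht1 (n := 2)]
  have hle := integral_rhoMP_le (he.trans_le hed) hd (by positivity) hδd hcon.le hmem.2.le
  rw [hintegral] at hle
  have hsq : Real.sqrt e * t ≤ Real.sqrt (Real.sqrt d * (Real.sqrt e * t ^ 2)) := by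
    refine Real.le_sqrt_of_sq_le ?_
    have : 0 ≤ Real.sqrt e * t ^ 2 := by positivity
    nlinarith
  have hmul : e * t ^ 3 ≤ Real.sqrt (Real.sqrt d * (Real.sqrt e * t ^ 2))
      * (Real.sqrt e * t ^ 2) := by
    refine le_trans (le_of_eq ?_) (mul_le_mul_of_nonneg_right hsq (by positivity))
    rw [show Real.sqrt e * t * (Real.sqrt e * t ^ 2) = Real.sqrt e ^ 2 * t ^ 3 by ring,
      Real.sq_sqrt he.le]
  have hdiv := div_le_div_of_nonneg_right hmul (by positivity : 0 ≤ 16 * Real.pi)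
  have : (j : ℝ) / p ≤ 1 - e * t ^ 3 / (16 * Real.pi) := by linarith
  rw [div_le_iff₀ hp0] at this
  linarith

/-- A solution of the mean-square equation for points close to Marchenko–Pastur quantiles stays
away from `0` and from the smallest point. -/
theorem exists_separation {e e' R₁ R₂ : ℝ} (he : 0 < e) (he' : e' < 1)
    (hR₁ : 0 < R₁) (hR₂ : 0 < R₂) :
    ∃ c₁ > 0, ∃ η > 0, ∃ ε > 0, ε ≤ 1 ∧ ∀ (p : ℕ) (d : ℝ) (γ g : ℕ → ℝ) (c : ℝ), 1 ≤ p → e ≤ d →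
      d ≤ e' → IsMPQuantile p d γ → (∀ j ∈ Finset.Icc 1 p, |g j - γ j| ≤ ε) →
      (∀ j ∈ Finset.Icc 1 p, g p ≤ g j) → c ∈ Set.Ioo 0 (g p) →
      R₁ ≤ (1 / (p : ℝ)) * ∑ j ∈ Finset.Icc 1 p, (c / (g j - c)) ^ 2 →
      (1 / (p : ℝ)) * ∑ j ∈ Finset.Icc 1 p, (c / (g j - c)) ^ 2 ≤ R₂ →
      c₁ ≤ c ∧ c ≤ g p - η := by
  have hα : 0 < aMP e' := aMP_pos he'
  set α := aMP e' with hαdef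
  set c₁ := α / 4 * min 1 (Real.sqrt R₁) with hc₁
  have hs1 : 0 < Real.sqrt R₁ := Real.sqrt_pos.2 hR₁
  have hc₁0 : 0 < c₁ := by positivity
  set t := min 1 (c₁ ^ 2 / (512 * Real.pi * R₂)) with ht
  have ht0 : 0 < t := by positivity
  have ht1 : t ≤ 1 := min_le_left _ _
  have hse : 0 < Real.sqrt e := Real.sqrt_pos.2 he
  set δ := Real.sqrt e * t ^ 2 with hδ
  have hδ0 : 0 < δ := by positivity
  refine ⟨c₁, hc₁0, δ, hδ0, min (min 1 δ) (α / 2), by positivity,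
    (min_le_left _ _).trans (min_le_left _ _), ?_⟩
  intro p d γ g c hp hed hde' hγ hgγ hmin hc hlow hup
  have hp0 : (0 : ℝ) < p := by exact_mod_cast hp
  have hpm : p ∈ Finset.Icc 1 p := Finset.mem_Icc.2 ⟨hp, le_rfl⟩
  have hεδ : ∀ j ∈ Finset.Icc 1 p, |g j - γ j| ≤ δ := fun j hj =>
    (hgγ j hj).trans ((min_le_left _ _).trans (min_le_right _ _))
  have hαd : α ≤ aMP d := by
    have h1 : Real.sqrt d ≤ Real.sqrt e' := Real.sqrt_le_sqrt hde'
    have h2 : Real.sqrt e' < 1 := by rw [Real.sqrt_lt' one_pos]; simpa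
    exact pow_le_pow_left₀ (by linarith) (by linarith) 2
  have hgp := abs_le.1 (hεδ p hpm)
  have hgp' := (abs_le.1 ((hgγ p hpm).trans (min_le_right _ _))).1
  rw [hγ.1] at hgp hgp'
  have hcpos : 0 < c := hc.1
  have hc1 : c₁ ≤ c := by
    by_contra! hlt
    have hc4 : c < α / 4 :=
      hlt.trans_le (mul_le_of_le_one_right (by positivity) (min_le_left _ _))
    have hcs : c < α / 4 * Real.sqrt R₁ :=
      hlt.trans_le (mul_le_mul_of_nonneg_left (min_le_right _ _) (by positivity))
    have hterm : ∀ j ∈ Finset.Icc 1 p, (c / (g j - c)) ^ 2 ≤ (c / (α / 4)) ^ 2 := by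
      intro j hj
      have hgj := hmin j hj
      have hgap : α / 4 ≤ g j - c := by linarith
      exact pow_le_pow_left₀ (div_nonneg hcpos.le (by linarith))
        (div_le_div_of_nonneg_left hcpos.le (by positivity) hgap) 2
    have hsum := Finset.sum_le_card_nsmul _ _ _ hterm
    rw [Nat.card_Icc, Nat.add_sub_cancel, nsmul_eq_mul] at hsum
    have hR : R₁ ≤ (c / (α / 4)) ^ 2 := by
      refine hlow.trans ?_
      rw [one_div, ← div_eq_inv_mul, div_le_iff₀ hp0]
      linarith
    have hlt' : c / (α / 4) < Real.sqrt R₁ := by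
      rw [div_lt_iff₀ (by positivity)]; linarith
    have := pow_lt_pow_left₀ hlt' (by positivity) two_ne_zero
    rw [Real.sq_sqrt hR₁.le] at this
    linarith
  refine ⟨hc1, ?_⟩
  by_contra! hgap
  have hκ : e * t ^ 3 / (16 * Real.pi) ≤ 1 := by
    rw [div_le_one (by positivity)]
    have := pow_le_one₀ ht0.le ht1 (n := 3)
    nlinarith [Real.pi_gt_three]
  have hmean := mul_sq_div_le_mean hp (D := 4 * δ) hcpos.le hκ (g := g) fun j hj hnear => by
    have h1 := hγ.le_of_near he hed (hde'.trans_lt he') ht0 ht1 hj hnear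
    have h2 := abs_le.1 (hεδ j hj)
    exact ⟨by linarith [hmin j hj, hc.2], by linarith⟩
  have hbig : R₂ < e * t ^ 3 / (16 * Real.pi) * (c / (4 * δ)) ^ 2 := by
    have h1 : e * t ^ 3 / (16 * Real.pi) * (c / (4 * δ)) ^ 2 = c ^ 2 / (256 * Real.pi * t) := by
      rw [div_pow, mul_pow, hδ, mul_pow, Real.sq_sqrt he.le]
      field_simp
      norm_num
    rw [h1, lt_div_iff₀ (by positivity)]
    have h2 : t ≤ c₁ ^ 2 / (512 * Real.pi * R₂) := min_le_right _ _
    rw [le_div_iff₀ (by positivity)] at h2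
    have h3 := pow_le_pow_left₀ hc₁0.le hc1 2
    have h4 : 0 < c₁ ^ 2 := by positivity
    linarith
  linarith

/-- Stability of the solution of the mean-square equation under perturbation of the points. -/
theorem abs_sub_mul_card_le {ι : Type*} {s : Finset ι} {γ g : ι → ℝ} {c c' c₁ η B : ℝ}
    (hc₁ : 0 < c₁) (hη : 0 < η) (hB : 0 < B) (hc : c₁ ≤ c) (hc' : c₁ ≤ c')
    (hγ : ∀ j ∈ s, η ≤ γ j - c ∧ γ j ≤ B) (hg : ∀ j ∈ s, η ≤ g j - c' ∧ g j ≤ B)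
    (hsum : ∑ j ∈ s, (c / (γ j - c)) ^ 2 = ∑ j ∈ s, (c' / (g j - c')) ^ 2) :
    |c' - c| * s.card ≤ B ^ 5 / (c₁ ^ 2 * η ^ 3) * ∑ j ∈ s, |g j - γ j| := by
  set w : ι → ℝ := fun j =>
    (c' / (g j - c') + c / (γ j - c)) / ((g j - c') * (γ j - c)) with hw
  have hwlow : ∀ j ∈ s, 2 * c₁ / B ^ 3 ≤ w j := by
    intro j hj
    obtain ⟨h1, h2⟩ := hγ j hj
    obtain ⟨h3, h4⟩ := hg j hj
    have a1 : c₁ / B ≤ c' / (g j - c') :=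
      div_le_div₀ (by linarith) hc' (by linarith) (by linarith)
    have a2 : c₁ / B ≤ c / (γ j - c) :=
      div_le_div₀ (by linarith) hc (by linarith) (by linarith)
    have a3 : (g j - c') * (γ j - c) ≤ B * B :=
      mul_le_mul (by linarith) (by linarith) (by linarith) (by linarith)
    have a4 : 0 < (g j - c') * (γ j - c) := mul_pos (by linarith) (by linarith)
    have a5 : 0 < c₁ / B := by positivity
    calc 2 * c₁ / B ^ 3 = (c₁ / B + c₁ / B) / (B * B) := by field_simp; norm_num
      _ ≤ w j := div_le_div₀ (by linarith) (by linarith) a4 a3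
  have hwup : ∀ j ∈ s, w j ≤ 2 * B / η ^ 3 := by
    intro j hj
    obtain ⟨h1, h2⟩ := hγ j hj
    obtain ⟨h3, h4⟩ := hg j hj
    have a1 : c' / (g j - c') ≤ B / η := div_le_div₀ hB.le (by linarith) hη h3
    have a2 : c / (γ j - c) ≤ B / η := div_le_div₀ hB.le (by linarith) hη h1
    have a3 : η * η ≤ (g j - c') * (γ j - c) := mul_le_mul h3 h1 hη.le (by linarith)
    have a5 : 0 < B / η := by positivity
    calc w j ≤ (B / η + B / η) / (η * η) :=
          div_le_div₀ (by linarith) (by linarith) (by positivity) a3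
      _ = 2 * B / η ^ 3 := by field_simp; norm_num
  have hterm : ∀ j ∈ s, (c' / (g j - c')) ^ 2 - (c / (γ j - c)) ^ 2
      = (c' - c) * (w j * γ j) - c * (w j * (g j - γ j)) := by
    intro j hj
    have h1 : γ j - c ≠ 0 := by linarith [(hγ j hj).1]
    have h3 : g j - c' ≠ 0 := by linarith [(hg j hj).1]
    simp only [hw]
    field_simp
    ring
  have hkey : (c' - c) * ∑ j ∈ s, w j * γ j = c * ∑ j ∈ s, w j * (g j - γ j) := by
    have := Finset.sum_congr rfl hterm
    rw [Finset.sum_sub_distrib, Finset.sum_sub_distrib, ← Finset.mul_sum, ← Finset.mul_sum,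
      hsum, sub_self] at this
    linarith
  rcases s.eq_empty_or_nonempty with rfl | ⟨i, hi⟩
  · simp
  have hcB : c ≤ B := by linarith [hγ i hi]
  have hlow : s.card * (2 * c₁ ^ 2 / B ^ 3) ≤ ∑ j ∈ s, w j * γ j := by
    rw [← nsmul_eq_mul]
    refine Finset.card_nsmul_le_sum _ _ _ fun j hj => ?_
    have h0 : 0 < 2 * c₁ / B ^ 3 := by positivity
    have := mul_le_mul (hwlow j hj) (by linarith [hγ j hj] : c₁ ≤ γ j) hc₁.le
      (h0.le.trans (hwlow j hj))
    refine le_trans (le_of_eq ?_) this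
    ring
  have hup : |c * ∑ j ∈ s, w j * (g j - γ j)| ≤ 2 * B ^ 2 / η ^ 3 * ∑ j ∈ s, |g j - γ j| := by
    rw [abs_mul, abs_of_pos (hc₁.trans_le hc)]
    have h1 : |∑ j ∈ s, w j * (g j - γ j)| ≤ 2 * B / η ^ 3 * ∑ j ∈ s, |g j - γ j| := by
      rw [Finset.mul_sum]
      refine (Finset.abs_sum_le_sum_abs _ _).trans (Finset.sum_le_sum fun j hj => ?_)
      have h0 : 0 < 2 * c₁ / B ^ 3 := by positivity
      rw [abs_mul, abs_of_pos (h0.trans_le (hwlow j hj))]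
      exact mul_le_mul_of_nonneg_right (hwup j hj) (abs_nonneg _)
    calc _ ≤ B * (2 * B / η ^ 3 * ∑ j ∈ s, |g j - γ j|) :=
          mul_le_mul hcB h1 (abs_nonneg _) hB.le
      _ = _ := by ring
  have hpos : 0 ≤ ∑ j ∈ s, w j * γ j := le_trans (by positivity) hlow
  rw [← hkey, abs_mul, abs_of_nonneg hpos] at hup
  have h := (mul_le_mul_of_nonneg_left hlow (abs_nonneg (c' - c))).trans hup
  refine le_of_mul_le_mul_right ?_ (by positivity : 0 < 2 * c₁ ^ 2 / B ^ 3)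
  calc _ = |c' - c| * (s.card * (2 * c₁ ^ 2 / B ^ 3)) := by ring
    _ ≤ _ := h
    _ = _ := by field_simp

theorem abs_one_div_pow_sub_le {x y L : ℝ} (hL : 0 < L) (hx : L ≤ x) (hy : L ≤ y) (k : ℕ) :
    |1 / x ^ k - 1 / y ^ k| ≤ k * (1 / L) ^ (k - 1 + 2) * |x - y| := by
  have hx0 := hL.trans_le hx
  have hy0 := hL.trans_le hy
  have h := abs_pow_sub_pow_le (1 / x) (1 / y) k
  rw [one_div_pow, one_div_pow, abs_of_pos (one_div_pos.2 hx0), abs_of_pos (one_div_pos.2 hy0)] at h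
  have hmax : max (1 / x) (1 / y) ≤ 1 / L :=
    max_le (one_div_le_one_div_of_le hL hx) (one_div_le_one_div_of_le hL hy)
  have hmax0 : 0 ≤ max (1 / x) (1 / y) := le_max_of_le_left (by positivity)
  have hdiff : |1 / x - 1 / y| ≤ (1 / L) ^ 2 * |x - y| := by
    have : 1 / x - 1 / y = (1 / x * (1 / y)) * (y - x) := by field_simp
    rw [this, abs_mul, abs_of_pos (by positivity), abs_sub_comm y x, sq]
    exact mul_le_mul_of_nonneg_right (mul_le_mul (one_div_le_one_div_of_le hL hx)
      (one_div_le_one_div_of_le hL hy) (by positivity) (by positivity)) (abs_nonneg _)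
  refine h.trans ?_
  calc _ ≤ ((1 / L) ^ 2 * |x - y|) * k * (1 / L) ^ (k - 1) :=
        mul_le_mul (mul_le_mul_of_nonneg_right hdiff (Nat.cast_nonneg _))
          (pow_le_pow_left₀ hmax0 hmax _) (by positivity) (by positivity)
    _ = _ := by rw [pow_add]; ring

/-- Lipschitz dependence of the resolvent power means on the point `c` and the points `γ`. -/
theorem abs_resolvent_mean_sub_le {ι : Type*} {s : Finset ι} {γ g : ι → ℝ} {c c' L N : ℝ}
    (hL : 0 < L) (hN : 0 ≤ N) (hc : L ≤ c) (hc' : L ≤ c')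
    (hγ : ∀ j ∈ s, L ≤ γ j - c) (hg : ∀ j ∈ s, L ≤ g j - c') (k : ℕ) :
    |(1 / c' ^ k) * (1 + (1 / N) * ∑ j ∈ s, (c' / (g j - c')) ^ k)
      - (1 / c ^ k) * (1 + (1 / N) * ∑ j ∈ s, (c / (γ j - c)) ^ k)|
    ≤ k * (1 / L) ^ (k - 1 + 2) *
      (|c' - c| + (1 / N) * (|c' - c| * s.card + ∑ j ∈ s, |g j - γ j|)) := by
  have key : ∀ (x : ℝ) (y : ι → ℝ), L ≤ x →
      (1 / x ^ k) * (1 + (1 / N) * ∑ j ∈ s, (x / (y j - x)) ^ k)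
        = 1 / x ^ k + (1 / N) * ∑ j ∈ s, 1 / (y j - x) ^ k := by
    intro x y hx
    have hx0 : x ≠ 0 := (hL.trans_le hx).ne'
    simp only [div_pow, div_eq_mul_one_div (x ^ k), ← Finset.mul_sum]
    field_simp
  rw [key c' g hc', key c γ hc]
  set K : ℝ := k * (1 / L) ^ (k - 1 + 2) with hK
  have h1 := abs_one_div_pow_sub_le hL hc' hc k
  have h2 : |∑ j ∈ s, 1 / (g j - c') ^ k - ∑ j ∈ s, 1 / (γ j - c) ^ k|
      ≤ K * (|c' - c| * s.card + ∑ j ∈ s, |g j - γ j|) := by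
    rw [← Finset.sum_sub_distrib]
    refine (Finset.abs_sum_le_sum_abs _ _).trans ?_
    have e : K * (|c' - c| * s.card + ∑ j ∈ s, |g j - γ j|)
        = ∑ j ∈ s, K * (|c' - c| + |g j - γ j|) := by
      rw [← Finset.mul_sum, Finset.sum_add_distrib, Finset.sum_const, nsmul_eq_mul]
      ring
    rw [e]
    refine Finset.sum_le_sum fun j hj => ?_
    refine (abs_one_div_pow_sub_le hL (hg j hj) (hγ j hj) k).trans ?_
    refine mul_le_mul_of_nonneg_left ?_ (by positivity)
    calc |g j - c' - (γ j - c)| = |(g j - γ j) - (c' - c)| := by ring_nf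
      _ ≤ |g j - γ j| + |c' - c| := abs_sub _ _
      _ = _ := add_comm _ _
  have hN' : 0 ≤ 1 / N := by positivity
  calc _ = |(1 / c' ^ k - 1 / c ^ k)
        + (1 / N) * (∑ j ∈ s, 1 / (g j - c') ^ k - ∑ j ∈ s, 1 / (γ j - c) ^ k)| := by ring_nf
    _ ≤ |1 / c' ^ k - 1 / c ^ k|
        + (1 / N) * |∑ j ∈ s, 1 / (g j - c') ^ k - ∑ j ∈ s, 1 / (γ j - c) ^ k| := by
        refine (abs_add_le _ _).trans ?_
        rw [abs_mul, abs_of_nonneg hN']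
    _ ≤ K * |c' - c| + (1 / N) * (K * (|c' - c| * s.card + ∑ j ∈ s, |g j - γ j|)) :=
        add_le_add h1 (mul_le_mul_of_nonneg_left h2 hN')
    _ = _ := by ring

theorem abs_resolvent_mean_sub_le_of_sum_eq {p : ℕ} (hp : 1 ≤ p) {γ g : ℕ → ℝ}
    {c c' L B N Q τ : ℝ} (hL : 0 < L) (hB : 0 < B) (hN : 0 < N) (hpN : (p : ℝ) ≤ Q * N)
    (hτ : 0 ≤ τ) (hc : L ≤ c) (hc' : L ≤ c')
    (hγ : ∀ j ∈ Finset.Icc 1 p, L ≤ γ j - c ∧ γ j ≤ B)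
    (hg : ∀ j ∈ Finset.Icc 1 p, L ≤ g j - c' ∧ g j ≤ B)
    (hsum : ∑ j ∈ Finset.Icc 1 p, (c / (γ j - c)) ^ 2
      = ∑ j ∈ Finset.Icc 1 p, (c' / (g j - c')) ^ 2)
    (hS : ∑ j ∈ Finset.Icc 1 p, |g j - γ j| ≤ τ * p) (k : ℕ) :
    |(1 / c' ^ k) * (1 + (1 / N) * ∑ j ∈ Finset.Icc 1 p, (c' / (g j - c')) ^ k)
      - (1 / c ^ k) * (1 + (1 / N) * ∑ j ∈ Finset.Icc 1 p, (c / (γ j - c)) ^ k)|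
    ≤ k * (1 / L) ^ (k - 1 + 2) *
      (B ^ 5 / L ^ 5 + Q * (B ^ 5 / L ^ 5 + 1)) * τ := by
  have hp0 : (0 : ℝ) < p := by exact_mod_cast hp
  have h1 := abs_sub_mul_card_le hL hL hB hc hc' hγ hg hsum
  have h2 := abs_resolvent_mean_sub_le hL hN.le hc hc' (fun j hj => (hγ j hj).1)
    (fun j hj => (hg j hj).1) k
  rw [Nat.card_Icc, Nat.add_sub_cancel] at h1 h2
  rw [← pow_add] at h1
  norm_num only at h1
  set A := B ^ 5 / L ^ 5 with hA
  have hA0 : 0 < A := by positivity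
  have h3 : |c' - c| * p ≤ A * τ * p := by nlinarith
  have h4 : |c' - c| ≤ A * τ := le_of_mul_le_mul_right h3 hp0
  have h5 : (1 / N) * (|c' - c| * p + ∑ j ∈ Finset.Icc 1 p, |g j - γ j|) ≤ Q * (A + 1) * τ := by
    rw [one_div, ← div_eq_inv_mul, div_le_iff₀ hN]
    have h6 := mul_le_mul_of_nonneg_left hpN (by positivity : 0 ≤ (A + 1) * τ)
    linarith
  refine h2.trans ?_
  rw [mul_assoc _ (A + _) τ]
  exact mul_le_mul_of_nonneg_left (by linarith) (by positivity)

theorem tendsto_div_one_of_one_div_pow_sub {x y : ℕ → ℝ} {r : ℕ → ℝ} {b : ℝ} (hb : 0 < b)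
    (hr : Tendsto r atTop (nhds 0)) (hx : ∀ᶠ p in atTop, 0 < x p)
    (hy : ∀ᶠ p in atTop, 0 < y p) (hyb : ∀ᶠ p in atTop, b ≤ 1 / y p ^ 3)
    (h : ∀ᶠ p in atTop, |1 / x p ^ 3 - 1 / y p ^ 3| ≤ r p) :
    Tendsto (fun p => x p / y p) atTop (nhds 1) := by
  have h1 : Tendsto (fun p => (y p / x p) ^ 3) atTop (nhds 1) := by
    have hr' : Tendsto (fun p => r p / b) atTop (nhds 0) := by simpa using hr.div_const b
    rw [← tendsto_sub_nhds_zero_iff]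
    refine squeeze_zero_norm' ?_ hr'
    filter_upwards [hx, hy, hyb, h] with p hx hy hyb h
    have e : (y p / x p) ^ 3 - 1 = (1 / x p ^ 3 - 1 / y p ^ 3) / (1 / y p ^ 3) := by
      field_simp
    rw [Real.norm_eq_abs, e, abs_div, abs_of_pos (hb.trans_le hyb)]
    exact div_le_div₀ ((abs_nonneg _).trans h) h hb hyb
  have h2 := h1.rpow_const (p := -(1 / 3 : ℝ)) (Or.inl one_ne_zero)
  rw [Real.one_rpow] at h2
  refine h2.congr' ?_
  filter_upwards [hx, hy] with p hx hy
  have hq : 0 < y p / x p := by positivity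
  rw [← Real.rpow_natCast, ← Real.rpow_mul hq.le]
  norm_num
  rw [Real.rpow_neg_one, inv_div]

/-- under Condition 3 with `0 < d₁ < 1`, there exists `ζ₀ > 0` such that for
any `ζ ∈ (0, ζ₀)`: if the perturbed quantiles `γ̂` stay within
`p^{ζ−2/3}(min(j,p+1−j))^{−1/3}` of the `γ_j` and `ĉ_p ∈ (0, γ̂_p)` solves
`(1/p)Σ (ĉ/(γ̂_j−ĉ))² = n/p`, then with `μ̂_p`, `σ̂_p` defined from `γ̂`, `ĉ`, one has
`|μ̂_p − μ_{p,0}| ≤ M p^{ζ−1}` and `|1/σ̂_p³ − 1/σ_{p,0}³| ≤ M p^{ζ−1}` for a constant `M`;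
consequently `n^{2/3}|μ̂_p − μ_{p,0}| → 0` and `σ̂_p/σ_{p,0} → 1`. -/
theorem stmt_11 (m n : ℕ → ℕ) (d₁ d₂ d₃ : ℝ)
    (hd₁ : d₁ ∈ Set.Ioo (0 : ℝ) 1) (hd₂ : 0 < d₂) (hd₃ : d₃ ∈ Set.Ioo (0 : ℝ) 1)
    (hm : Tendsto (fun p : ℕ => (p : ℝ) / m p) atTop (nhds d₁))
    (hn : Tendsto (fun p : ℕ => (p : ℝ) / n p) atTop (nhds d₂))
    (hmn : Tendsto (fun p : ℕ => (p : ℝ) / ((m p : ℝ) + n p)) atTop (nhds d₃))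
    (γq : ℕ → ℕ → ℝ)
    (hγq : ∀ᶠ p : ℕ in atTop,
      γq p 0 = bMP ((p : ℝ) / m p) ∧ γq p p = aMP ((p : ℝ) / m p) ∧
      ∀ j, 1 ≤ j → j ≤ p - 1 →
        γq p j ∈ Set.Ioo (aMP ((p : ℝ) / m p)) (bMP ((p : ℝ) / m p)) ∧
        (∫ x in (γq p j)..(bMP ((p : ℝ) / m p)), rhoMP ((p : ℝ) / m p) x) = (j : ℝ) / p)
    (c₀ : ℕ → ℝ)
    (hc₀ : ∀ᶠ p : ℕ in atTop,
      c₀ p ∈ Set.Ioo 0 (aMP ((p : ℝ) / m p)) ∧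
      (1 / (p : ℝ)) * ∑ j ∈ Finset.Icc 1 p, (c₀ p / (γq p j - c₀ p)) ^ 2 = (n p : ℝ) / p)
    (μ₀ : ℕ → ℝ)
    (hμ₀ : ∀ p, μ₀ p = (1 / c₀ p) *
        (1 + (1 / (n p : ℝ)) * ∑ j ∈ Finset.Icc 1 p, c₀ p / (γq p j - c₀ p)))
    (σ₀ : ℕ → ℝ)
    (hσ₀ : ∀ᶠ p : ℕ in atTop, 0 < σ₀ p ∧
      1 / σ₀ p ^ 3 = (1 / c₀ p ^ 3) *
        (1 + (1 / (n p : ℝ)) * ∑ j ∈ Finset.Icc 1 p, (c₀ p / (γq p j - c₀ p)) ^ 3)) :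
    ∃ ζ₀ : ℝ, 0 < ζ₀ ∧ ∀ ζ ∈ Set.Ioo 0 ζ₀,
      ∀ γh : ℕ → ℕ → ℝ, ∀ ch μh σh : ℕ → ℝ,
        (∀ᶠ p : ℕ in atTop,
          (∀ j k : ℕ, 1 ≤ j → j ≤ k → k ≤ p → γh p k ≤ γh p j) ∧
          0 < γh p p ∧
          (∀ j, 1 ≤ j → j ≤ p →
            |γh p j - γq p j| ≤
              (p : ℝ) ^ (ζ - 2 / 3) * ((min j (p + 1 - j) : ℕ) : ℝ) ^ (-(1 : ℝ) / 3)) ∧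
          ch p ∈ Set.Ioo 0 (γh p p) ∧
          (1 / (p : ℝ)) * ∑ j ∈ Finset.Icc 1 p, (ch p / (γh p j - ch p)) ^ 2 = (n p : ℝ) / p ∧
          μh p = (1 / ch p) *
            (1 + (1 / (n p : ℝ)) * ∑ j ∈ Finset.Icc 1 p, ch p / (γh p j - ch p)) ∧
          0 < σh p ∧
          1 / σh p ^ 3 = (1 / ch p ^ 3) *
            (1 + (1 / (n p : ℝ)) * ∑ j ∈ Finset.Icc 1 p, (ch p / (γh p j - ch p)) ^ 3)) →
        (∃ M : ℝ, ∀ᶠ p : ℕ in atTop,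
            |μh p - μ₀ p| ≤ M * (p : ℝ) ^ (ζ - 1) ∧
            |1 / σh p ^ 3 - 1 / σ₀ p ^ 3| ≤ M * (p : ℝ) ^ (ζ - 1)) ∧
          Tendsto (fun p : ℕ => (n p : ℝ) ^ ((2 : ℝ) / 3) * |μh p - μ₀ p|) atTop (nhds 0) ∧
          Tendsto (fun p : ℕ => σh p / σ₀ p) atTop (nhds 1) := by
  obtain ⟨hd₁0, hd₁1⟩ := hd₁
  have hR₁ : 0 < 1 / (2 * d₂) := by positivity
  have hR₂ : 0 < 2 / d₂ := by positivity
  obtain ⟨c₁, hc₁, η, hη, ε, hε, hε1, hsep⟩ := exists_separation (e := d₁ / 2)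
    (e' := (1 + d₁) / 2) (by linarith) (by linarith) hR₁ hR₂
  have hL : 0 < min c₁ (η / 2) := by positivity
  set L := min c₁ (η / 2) with hLdef
  refine ⟨1 / 3, by norm_num, ?_⟩
  rintro ζ ⟨hζ0, hζ⟩ γh ch μh σh hyp
  set C : ℕ → ℝ := fun k => k * (1 / L) ^ (k - 1 + 2) *
    ((5 : ℝ) ^ 5 / L ^ 5 + 2 * d₂ * ((5 : ℝ) ^ 5 / L ^ 5 + 1)) * 3 with hC
  have hC0 : ∀ k, 0 ≤ C k := fun k => by positivity
  have hratio : ∀ᶠ p : ℕ in atTop, 0 < (n p : ℝ) ∧ (p : ℝ) ≤ 2 * d₂ * n p ∧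
      1 / (2 * d₂) ≤ (n p : ℝ) / p ∧ (n p : ℝ) / p ≤ 2 / d₂ := by
    filter_upwards [hn.eventually_lt_const (by linarith : d₂ < 2 * d₂),
      hn.eventually_const_lt (by linarith : d₂ / 2 < d₂), eventually_ge_atTop 1] with p h1 h2 hp
    have hp0 : (0 : ℝ) < p := by exact_mod_cast hp
    have hn0 : (0 : ℝ) < n p := by
      rcases (Nat.cast_nonneg (α := ℝ) (n p)).eq_or_lt with h | h
      · rw [← h, div_zero] at h2; linarith
      · exact h
    rw [div_lt_iff₀ hn0] at h1
    rw [lt_div_iff₀ hn0] at h2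
    refine ⟨hn0, h1.le, ?_, ?_⟩
    · rw [div_le_div_iff₀ (by positivity) hp0]; linarith
    · rw [div_le_div_iff₀ hp0 hd₂]; linarith
  have hsmall : Tendsto (fun p : ℕ => (p : ℝ) ^ (ζ - 2 / 3)) atTop (nhds 0) := by
    have := (tendsto_rpow_neg_atTop (by linarith : 0 < 2 / 3 - ζ)).comp
      tendsto_natCast_atTop_atTop
    simpa only [neg_sub, Function.comp_def] using this
  have hmain : ∀ᶠ p : ℕ in atTop, c₀ p ∈ Set.Ioo 0 4 ∧ ∀ k : ℕ,
      |(1 / ch p ^ k) * (1 + (1 / (n p : ℝ)) *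
          ∑ j ∈ Finset.Icc 1 p, (ch p / (γh p j - ch p)) ^ k)
        - (1 / c₀ p ^ k) * (1 + (1 / (n p : ℝ)) *
          ∑ j ∈ Finset.Icc 1 p, (c₀ p / (γq p j - c₀ p)) ^ k)| ≤ C k * (p : ℝ) ^ (ζ - 1) := by
    filter_upwards [hyp, hγq, hc₀, hratio, eventually_ge_atTop 1,
      hm.eventually_const_lt (by linarith : d₁ / 2 < d₁),
      hm.eventually_lt_const (by linarith : d₁ < (1 + d₁) / 2),
      hsmall.eventually_lt_const (by positivity : 0 < min ε (η / 2))]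
      with p hyp hγq hc₀ hratio hp hde hde' hps
    obtain ⟨hanti, -, hclose, hch, hchsum, -, -, -⟩ := hyp
    obtain ⟨hn0, hpn, hr1, hr2⟩ := hratio
    have hp0 : (0 : ℝ) < p := by exact_mod_cast hp
    have hq : IsMPQuantile p ((p : ℝ) / m p) (γq p) := hγq.2
    have hd1 : (p : ℝ) / m p < 1 := by linarith
    have hb4 := bMP_le_four hd1
    have hclose' : ∀ j ∈ Finset.Icc 1 p, |γh p j - γq p j| ≤ min ε (η / 2) := by
      intro j hj
      have hj' := Finset.mem_Icc.1 hj
      refine (hclose j hj'.1 hj'.2).trans (le_trans ?_ hps.le)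
      refine mul_le_of_le_one_right (by positivity) ?_
      refine Real.rpow_le_one_of_one_le_of_nonpos ?_ (by norm_num)
      have : 1 ≤ min j (p + 1 - j) := by omega
      exact_mod_cast this
    have hqmin : ∀ j ∈ Finset.Icc 1 p, γq p p ≤ γq p j := fun j hj => by
      rw [hq.1]; exact (hq.mem_Icc hj).1
    have hhmin : ∀ j ∈ Finset.Icc 1 p, γh p p ≤ γh p j := fun j hj => by
      have hj' := Finset.mem_Icc.1 hj
      exact hanti j p hj'.1 hj'.2 le_rfl
    obtain ⟨s1, s2⟩ := hsep p _ (γq p) (γq p) (c₀ p) hp hde.le hde'.le hq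
      (fun j _ => by simpa using hε.le) hqmin (by rw [hq.1]; exact hc₀.1)
      (by rw [hc₀.2]; exact hr1) (by rw [hc₀.2]; exact hr2)
    obtain ⟨s3, s4⟩ := hsep p _ (γq p) (γh p) (ch p) hp hde.le hde'.le hq
      (fun j hj => (hclose' j hj).trans (min_le_left _ _)) hhmin hch
      (by rw [hchsum]; exact hr1) (by rw [hchsum]; exact hr2)
    have hLc : L ≤ c₁ := min_le_left _ _
    have hLη : L ≤ η := (min_le_right _ _).trans (by linarith)
    refine ⟨⟨hc₀.1.1, ?_⟩, fun k => ?_⟩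
    · have := hq.mem_Icc (Finset.mem_Icc.2 ⟨hp, le_rfl⟩)
      rw [hq.1] at this
      linarith [hc₀.1.2, this.2]
    have hS : ∑ j ∈ Finset.Icc 1 p, |γh p j - γq p j| ≤ 3 * (p : ℝ) ^ (ζ - 1) * p := by
      calc _ ≤ ∑ j ∈ Finset.Icc 1 p, (p : ℝ) ^ (ζ - 2 / 3)
            * ((min j (p + 1 - j) : ℕ) : ℝ) ^ (-(1 : ℝ) / 3) :=
            Finset.sum_le_sum fun j hj =>
              hclose j (Finset.mem_Icc.1 hj).1 (Finset.mem_Icc.1 hj).2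
        _ ≤ (p : ℝ) ^ (ζ - 2 / 3) * (3 * (p : ℝ) ^ ((2 : ℝ) / 3)) := by
            rw [← Finset.mul_sum]
            exact mul_le_mul_of_nonneg_left (sum_Icc_min_rpow_neg_third_le p) (by positivity)
        _ = 3 * ((p : ℝ) ^ (ζ - 2 / 3) * (p : ℝ) ^ ((2 : ℝ) / 3)) := by ring
        _ = 3 * ((p : ℝ) ^ (ζ - 1) * (p : ℝ) ^ (1 : ℝ)) := by
            rw [← Real.rpow_add hp0, ← Real.rpow_add hp0]; ring_nf
        _ = _ := by rw [Real.rpow_one]; ring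
    have hsum : ∑ j ∈ Finset.Icc 1 p, (c₀ p / (γq p j - c₀ p)) ^ 2
        = ∑ j ∈ Finset.Icc 1 p, (ch p / (γh p j - ch p)) ^ 2 :=
      mul_left_cancel₀ (one_div_pos.2 hp0).ne' (hc₀.2.trans hchsum.symm)
    refine (abs_resolvent_mean_sub_le_of_sum_eq hp hL (by norm_num : (0 : ℝ) < 5) hn0 hpn
      (by positivity : 0 ≤ 3 * (p : ℝ) ^ (ζ - 1)) (hLc.trans s1) (hLc.trans s3)
      (fun j hj => ⟨by linarith [hqmin j hj], by linarith [(hq.mem_Icc hj).2]⟩)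
      (fun j hj => ⟨by linarith [hhmin j hj], ?_⟩) hsum hS k).trans (le_of_eq ?_)
    · have := (abs_le.1 ((hclose' j hj).trans (min_le_left _ _))).2
      linarith [(hq.mem_Icc hj).2]
    · simp only [hC]; ring
  have hμ : ∀ᶠ p : ℕ in atTop, |μh p - μ₀ p| ≤ C 1 * (p : ℝ) ^ (ζ - 1) := by
    filter_upwards [hmain, hyp] with p hmain hyp
    obtain ⟨-, -, -, -, -, hμh, -, -⟩ := hyp
    have := hmain.2 1
    simp only [pow_one] at this
    rwa [hμh, hμ₀]
  have hσ : ∀ᶠ p : ℕ in atTop, |1 / σh p ^ 3 - 1 / σ₀ p ^ 3| ≤ C 3 * (p : ℝ) ^ (ζ - 1) := by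
    filter_upwards [hmain, hyp, hσ₀] with p hmain hyp hσ₀
    obtain ⟨-, -, -, -, -, -, -, hσh⟩ := hyp
    rw [hσh, hσ₀.2]
    exact hmain.2 3
  refine ⟨⟨max (C 1) (C 3), ?_⟩, ?_, ?_⟩
  · filter_upwards [hμ, hσ] with p hμ hσ
    exact ⟨hμ.trans (mul_le_mul_of_nonneg_right (le_max_left _ _) (by positivity)),
      hσ.trans (mul_le_mul_of_nonneg_right (le_max_right _ _) (by positivity))⟩
  · have hlim : Tendsto (fun p : ℕ => (2 / d₂) ^ ((2 : ℝ) / 3) * C 1 * (p : ℝ) ^ (ζ - 1 / 3))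
        atTop (nhds 0) := by
      have := ((tendsto_rpow_neg_atTop (by linarith : 0 < 1 / 3 - ζ)).comp
        tendsto_natCast_atTop_atTop).const_mul ((2 / d₂) ^ ((2 : ℝ) / 3) * C 1)
      simpa only [neg_sub, mul_zero, Function.comp_def] using this
    refine squeeze_zero' (Eventually.of_forall fun p => by positivity) ?_ hlim
    filter_upwards [hμ, hratio, eventually_ge_atTop 1] with p hμ hratio hp
    have hp0 : (0 : ℝ) < p := by exact_mod_cast hp
    have hnp := hratio.2.2.2
    rw [div_le_iff₀ hp0] at hnp
    have h1 : (n p : ℝ) ^ ((2 : ℝ) / 3) ≤ (2 / d₂) ^ ((2 : ℝ) / 3) * (p : ℝ) ^ ((2 : ℝ) / 3) := by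
      rw [← Real.mul_rpow hR₂.le hp0.le]
      exact Real.rpow_le_rpow hratio.1.le hnp (by norm_num)
    calc _ ≤ ((2 / d₂) ^ ((2 : ℝ) / 3) * (p : ℝ) ^ ((2 : ℝ) / 3))
          * (C 1 * (p : ℝ) ^ (ζ - 1)) := mul_le_mul h1 hμ (abs_nonneg _) (by positivity)
      _ = (2 / d₂) ^ ((2 : ℝ) / 3) * C 1 * ((p : ℝ) ^ ((2 : ℝ) / 3) * (p : ℝ) ^ (ζ - 1)) := by ring
      _ = _ := by rw [← Real.rpow_add hp0]; ring_nf
  · have hlim : Tendsto (fun p : ℕ => C 3 * (p : ℝ) ^ (ζ - 1)) atTop (nhds 0) := by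
      have := ((tendsto_rpow_neg_atTop (by linarith : 0 < 1 - ζ)).comp
        tendsto_natCast_atTop_atTop).const_mul (C 3)
      simpa only [neg_sub, mul_zero, Function.comp_def] using this
    refine tendsto_div_one_of_one_div_pow_sub (b := 1 / 4 ^ 3) (by norm_num) hlim
      (hyp.mono fun p h => h.2.2.2.2.2.2.1) (hσ₀.mono fun p h => h.1) ?_ hσ
    filter_upwards [hmain, hσ₀, hc₀, hγq, hratio, eventually_ge_atTop 1]
      with p hmain hσ₀ hc₀ hγq hratio hp
    have hq : IsMPQuantile p ((p : ℝ) / m p) (γq p) := hγq.2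
    have hcpos : 0 < c₀ p := hmain.1.1
    have hsum : 0 ≤ ∑ j ∈ Finset.Icc 1 p, (c₀ p / (γq p j - c₀ p)) ^ 3 := by
      refine Finset.sum_nonneg fun j hj => pow_nonneg (div_nonneg hcpos.le ?_) 3
      linarith [(hq.mem_Icc hj).1, hc₀.1.2]
    have hn0 := hratio.1
    rw [hσ₀.2]
    have h1 : 1 / (4 : ℝ) ^ 3 ≤ 1 / c₀ p ^ 3 :=
      one_div_le_one_div_of_le (by positivity) (pow_le_pow_left₀ hcpos.le hmain.1.2.le 3)
    refine h1.trans (le_mul_of_one_le_right (by positivity) ?_)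
    have : 0 ≤ 1 / (n p : ℝ) * ∑ j ∈ Finset.Icc 1 p, (c₀ p / (γq p j - c₀ p)) ^ 3 := by positivity
    linarith
end
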